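/- If (U₁,U₂,<) is a hereditarily staggered extended word equation that is terminating, then its cut graph G_{U₁,U₂,<} is acyclic. -/

import Mathlib

open scoped Classical

namespace ExtWordEq

/-- The type of (candidate) boundary orders: relations on pairs (i,j). -/
abbrev BRel : Type := ℕ × ℕ → ℕ × ℕ → Prop

variable {X : Type*}

/-- The `i`-th side of the word equation (`i = 1` gives `U₁`, anything else `U₂`). -/
def word (U₁ U₂ : List X) (i : ℕ) : List X := if i = 1 then U₁ else U₂

/-- The variable `U_{i,j}` (1-indexed), as an optional value. -/
def letter (U₁ U₂ : List X) (b : ℕ × ℕ) : Option X := (word U₁ U₂ b.1)[b.2 - 1]?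

/-- `b` is a boundary of the word equation `(U₁, U₂)`. -/
def Boundary (U₁ U₂ : List X) (b : ℕ × ℕ) : Prop :=
  (b.1 = 1 ∨ b.1 = 2) ∧ 1 ≤ b.2 ∧ b.2 ≤ (word U₁ U₂ b.1).length

/-- `b` is a boundary of `(U₁, U₂)` or one of the conventional boundaries `(1,0)`, `(2,0)`. -/
def EBoundary (U₁ U₂ : List X) (b : ℕ × ℕ) : Prop :=
  (b.1 = 1 ∨ b.1 = 2) ∧ b.2 ≤ (word U₁ U₂ b.1).length

/-- Incomparability `a ≈ b` for a strict order. -/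
def Incomp (lt : BRel) (a b : ℕ × ℕ) : Prop := ¬ lt a b ∧ ¬ lt b a

/-- `lt` is a boundary order for the word equation `(U₁, U₂)`:
a strict weak order on the boundaries (together with the conventional boundaries
`(1,0) ≈ (2,0)`), extending `(i,j) < (i,j+1)` and with `(1,m) ≈ (2,n)`. -/
structure BoundaryOrder (U₁ U₂ : List X) (lt : BRel) : Prop where
  irrefl : ∀ a, EBoundary U₁ U₂ a → ¬ lt a a
  trans : ∀ a b c, EBoundary U₁ U₂ a → EBoundary U₁ U₂ b → EBoundary U₁ U₂ c →
    lt a b → lt b c → lt a c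
  incomp_trans : ∀ a b c, EBoundary U₁ U₂ a → EBoundary U₁ U₂ b → EBoundary U₁ U₂ c →
    Incomp lt a b → Incomp lt b c → Incomp lt a c
  succ : ∀ i j : ℕ, EBoundary U₁ U₂ (i, j + 1) → lt (i, j) (i, j + 1)
  top : Incomp lt (1, U₁.length) (2, U₂.length)
  bot : Incomp lt (1, 0) (2, 0)

/-- `L(U_{i,1} U_{i,2} ⋯ U_{i,j})` where `L` is the additive extension of a length
assignment on variables. -/
def prefixLen (U₁ U₂ : List X) (L : X → ℕ) (b : ℕ × ℕ) : ℕ :=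
  (((word U₁ U₂ b.1).take b.2).map L).sum

/-- The extended word equation `(U₁, U₂, lt)` is coherent. -/
def Coherent (U₁ U₂ : List X) (lt : BRel) : Prop :=
  ∃ L : X → ℕ, (∀ x, 0 < L x) ∧
    ∀ a b, Boundary U₁ U₂ a → Boundary U₁ U₂ b →
      (lt a b ↔ prefixLen U₁ U₂ L a < prefixLen U₁ U₂ L b)

/-- The boundary `a` cuts the boundary `b`. -/
def Cuts (U₁ U₂ : List X) (lt : BRel) (a b : ℕ × ℕ) : Prop :=
  Boundary U₁ U₂ a ∧ Boundary U₁ U₂ b ∧ a ≠ b ∧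
    lt (a.1, a.2 - 1) b ∧ lt (b.1, b.2 - 1) a

/-- The boundary `a` mirrors the boundary `b`. -/
def Mirrors (U₁ U₂ : List X) (lt : BRel) (a b : ℕ × ℕ) : Prop :=
  Boundary U₁ U₂ a ∧ Boundary U₁ U₂ b ∧ letter U₁ U₂ a = letter U₁ U₂ b ∧
    (¬ Incomp lt a b ∨ ¬ Incomp lt (a.1, a.2 - 1) (b.1, b.2 - 1))

/-- Edge relation of the cut graph `G_{U₁,U₂,<}`. -/
def CutEdge (U₁ U₂ : List X) (lt : BRel) (a b : ℕ × ℕ) : Prop :=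
  ∃ c, Cuts U₁ U₂ lt a c ∧ Mirrors U₁ U₂ lt c b

/-- `w 0, w 1, …, w n` is a cycle (of length `n ≥ 1`) in the cut graph. -/
def IsCycle (U₁ U₂ : List X) (lt : BRel) (n : ℕ) (w : ℕ → ℕ × ℕ) : Prop :=
  0 < n ∧ w n = w 0 ∧ ∀ k < n, CutEdge U₁ U₂ lt (w k) (w (k + 1))

/-- The cut graph `G_{U₁,U₂,<}` is acyclic. -/
def Acyclic (U₁ U₂ : List X) (lt : BRel) : Prop :=
  ¬ ∃ n w, IsCycle U₁ U₂ lt n w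

variable [DecidableEq X]

/-- Case I extended Nielsen transformation (here `x = U_{1,1}`, `y = U_{2,1}`,
and `T(y) = x`). -/
def NielsenI (U₁ U₂ : List X) (lt : BRel) (U₁' U₂' : List X) (lt' : BRel) : Prop :=
  ∃ x y : X, U₁.head? = some x ∧ U₂.head? = some y ∧
    Incomp lt (1, 1) (2, 1) ∧
    U₁' = (U₁.map fun z => if z = y then x else z).tail ∧
    U₂' = (U₂.map fun z => if z = y then x else z).tail ∧
    BoundaryOrder U₁' U₂' lt' ∧
    ∀ a b : ℕ × ℕ, EBoundary U₁' U₂' a → EBoundary U₁' U₂' b →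
      (lt' a b ↔ lt (a.1, a.2 + 1) (b.1, b.2 + 1))

/-- The substitution `T(x) = y x` (identity on other variables), applied to a word. -/
def expand (x y : X) (l : List X) : List X :=
  l.flatMap fun z => if z = x then [y, x] else [z]

/-- The map `μ(i,j) = j + #{j' ≤ j : U_{i,j'} = x} − 1` (as a map on boundaries),
where `x = U_{1,1}`. -/
def mu (U₁ U₂ : List X) (x : X) (b : ℕ × ℕ) : ℕ × ℕ :=
  (b.1, b.2 + ((word U₁ U₂ b.1).take b.2).count x - 1)

/-- The map `ν(i,j) = j − #{j' ≤ j : U'_{i,j'} = x} + 1` (as a map on boundaries),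
where `x = U_{1,1}`. -/
def nu (U₁' U₂' : List X) (x : X) (b : ℕ × ℕ) : ℕ × ℕ :=
  (b.1, b.2 - ((word U₁' U₂' b.1).take b.2).count x + 1)

/-- Membership in `B⁻ = B ∖ {(2,1)}`. -/
def Bminus (U₁ U₂ : List X) (b : ℕ × ℕ) : Prop := Boundary U₁ U₂ b ∧ b ≠ (2, 1)

/-- Membership in `B'⁻ = {(i, μ(i,j)) : (i,j) ∈ B⁻}` (`x = U_{1,1}`). -/
def Bpminus (U₁ U₂ : List X) (x : X) (b' : ℕ × ℕ) : Prop :=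
  ∃ b, Bminus U₁ U₂ b ∧ mu U₁ U₂ x b = b'

/-- Case II extended Nielsen transformation, with the heads `x = U_{1,1}`,
`y = U_{2,1}` made explicit. -/
def NielsenIIxy (U₁ U₂ : List X) (lt : BRel) (U₁' U₂' : List X) (lt' : BRel)
    (x y : X) : Prop :=
  U₁.head? = some x ∧ U₂.head? = some y ∧
  lt (2, 1) (1, 1) ∧
  U₁' = (expand x y U₁).tail ∧
  U₂' = (expand x y U₂).tail ∧
  BoundaryOrder U₁' U₂' lt' ∧
  ∀ a b, Bpminus U₁ U₂ x a → Bpminus U₁ U₂ x b →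
    (lt' a b ↔ lt (nu U₁' U₂' x a) (nu U₁' U₂' x b))

/-- Case II extended Nielsen transformation. -/
def NielsenII (U₁ U₂ : List X) (lt : BRel) (U₁' U₂' : List X) (lt' : BRel) : Prop :=
  ∃ x y : X, NielsenIIxy U₁ U₂ lt U₁' U₂' lt' x y

/-- The dual boundary order. -/
def dualRel (lt : BRel) : BRel := fun a b => lt (3 - a.1, a.2) (3 - b.1, b.2)

/-- Case III extended Nielsen transformation: case II applied to the dual,
then dualized back. -/
def NielsenIII (U₁ U₂ : List X) (lt : BRel) (U₁' U₂' : List X) (lt' : BRel) : Prop :=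
  NielsenII U₂ U₁ (dualRel lt) U₂' U₁' (dualRel lt')

/-- `(U₁', U₂', lt')` is an extended Nielsen transformation of the nontrivial coherent
extended word equation `(U₁, U₂, lt)`. -/
def ExtNielsen (U₁ U₂ : List X) (lt : BRel) (U₁' U₂' : List X) (lt' : BRel) : Prop :=
  U₁ ≠ [] ∧ U₂ ≠ [] ∧ BoundaryOrder U₁ U₂ lt ∧ Coherent U₁ U₂ lt ∧
    (NielsenI U₁ U₂ lt U₁' U₂' lt' ∨ NielsenII U₁ U₂ lt U₁' U₂' lt' ∨
      NielsenIII U₁ U₂ lt U₁' U₂' lt')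

/-- A coherent extended Nielsen transformation. -/
def CohNielsen (U₁ U₂ : List X) (lt : BRel) (U₁' U₂' : List X) (lt' : BRel) : Prop :=
  ExtNielsen U₁ U₂ lt U₁' U₂' lt' ∧ Coherent U₁' U₂' lt'

/-- `(U₁, U₂, lt)` is (strongly) terminating: there is no infinite sequence of coherent
extended Nielsen transformations starting from it. -/
def Terminating (U₁ U₂ : List X) (lt : BRel) : Prop :=
  ¬ ∃ f : ℕ → List X × List X × BRel,
    f 0 = (U₁, U₂, lt) ∧
    ∀ n, CohNielsen (f n).1 (f n).2.1 (f n).2.2 (f (n + 1)).1 (f (n + 1)).2.1 (f (n + 1)).2.2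


/-- `(U₁, U₂, lt)` is staggered: `(1,j) ≈ (2,j')` only for `(j,j') = (0,0)` and
`(j,j') = (m,n)`. -/
def Staggered (U₁ U₂ : List X) (lt : BRel) : Prop :=
  ∀ j j' : ℕ, j ≤ U₁.length → j' ≤ U₂.length → Incomp lt (1, j) (2, j') →
    (j = 0 ∧ j' = 0) ∨ (j = U₁.length ∧ j' = U₂.length)

/-- `P` is a set of staggered coherent extended word equations such that every
nontrivial member admits a coherent extended Nielsen transformation to a staggered
extended word equation, and every staggered result of a coherent extended Nielsen
transformation of a member is again a member. -/
def HSClosed (P : List X → List X → BRel → Prop) : Prop :=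
  ∀ U₁ U₂ lt, P U₁ U₂ lt →
    BoundaryOrder U₁ U₂ lt ∧ Coherent U₁ U₂ lt ∧ Staggered U₁ U₂ lt ∧
    (U₁ ≠ [] → U₂ ≠ [] →
      ∃ U₁' U₂' lt', CohNielsen U₁ U₂ lt U₁' U₂' lt' ∧ Staggered U₁' U₂' lt') ∧
    (∀ U₁' U₂' lt', CohNielsen U₁ U₂ lt U₁' U₂' lt' → Staggered U₁' U₂' lt' →
      P U₁' U₂' lt')

/-- `(U₁, U₂, lt)` is hereditarily staggered: it belongs to the largest set of
staggered coherent extended word equations with the two closure properties. -/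
def HereditarilyStaggered (U₁ U₂ : List X) (lt : BRel) : Prop :=
  ∃ P : List X → List X → BRel → Prop, HSClosed P ∧ P U₁ U₂ lt

set_option linter.unusedSectionVars false

section Weights

open Relation

/-- An alternating-acyclic bipartite-like overlap structure carries a symmetric weight, positive
exactly on overlapping pairs, whose row sums depend only on the label. -/
theorem exists_weights {α κ : Type*} [Fintype α] (O : α → α → Prop)
    (hsymm : ∀ a c, O a c → O c a) (l : α → κ) (hne : ∀ a, ∃ c, O a c)
    (hac : ∀ a, ¬ TransGen (fun a b => ∃ c, O a c ∧ c ≠ b ∧ l c = l b) a a) :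
    ∃ f : α → α → ℕ, (∀ a c, f a c = f c a) ∧ (∀ a c, O a c ↔ 0 < f a c) ∧
      ∀ a b, l a = l b → ∑ c, f a c = ∑ c, f b c := by
  set E : α → α → Prop := fun a b => ∃ c, O a c ∧ c ≠ b ∧ l c = l b with hE
  have hwf : WellFounded (fun b a => E a b) := by
    have : Std.Irrefl (TransGen fun b a => E a b) :=
      ⟨fun a h => hac a (transGen_swap.1 h)⟩
    exact WellFounded.mono (Finite.wellFounded_of_trans_of_irrefl (TransGen fun b a => E a b))
      fun _ _ h => TransGen.single h
  obtain ⟨N, hN⟩ : ∃ N : α → ℕ, ∀ a, N a =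
      ∑ c, if O a c then ∏ b, if c ≠ b ∧ l c = l b then N b else 1 else 0 := by
    refine ⟨hwf.fix (C := fun _ => ℕ) fun a ih => ∑ c, if h : O a c then
      ∏ b, if h' : c ≠ b ∧ l c = l b then ih b ⟨c, h, h'⟩ else 1 else 0, fun a => ?_⟩
    rw [hwf.fix_eq]
    simp only [dite_eq_ite]
  set M : α → ℕ := fun c => ∏ b, if c ≠ b ∧ l c = l b then N b else 1 with hM
  have hNM : ∀ a, N a = ∑ c, if O a c then M c else 0 := hN
  have hpos : ∀ a, 0 < N a := by
    intro a
    induction a using hwf.induction with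
    | _ a ih =>
      obtain ⟨c, hc⟩ := hne a
      rw [hNM]
      refine Finset.sum_pos' (fun _ _ => Nat.zero_le _) ⟨c, Finset.mem_univ _, ?_⟩
      rw [if_pos hc]
      refine Finset.prod_pos fun b _ => ?_
      split_ifs with h
      · exact ih b ⟨c, hc, h⟩
      · exact Nat.one_pos
  have hMpos : ∀ a, 0 < M a := by
    intro a
    refine Finset.prod_pos fun b _ => ?_
    split_ifs with h
    · exact hpos b
    · exact Nat.one_pos
  have hrow : ∀ a, ∑ c, (if O a c then M a * M c else 0) = ∏ b, if l a = l b then N b else 1 := by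
    intro a
    have h1 : ∑ c, (if O a c then M a * M c else 0) = M a * N a := by
      rw [hNM, Finset.mul_sum]
      exact Finset.sum_congr rfl fun c _ => by split_ifs <;> simp
    have h2 : M a = ∏ b, if a ≠ b ∧ l a = l b then N b else 1 := rfl
    rw [h1, h2, ← Finset.mul_prod_erase Finset.univ (fun b => if l a = l b then N b else 1)
      (Finset.mem_univ a), ← Finset.mul_prod_erase Finset.univ
      (fun b => if a ≠ b ∧ l a = l b then N b else 1) (Finset.mem_univ a)]
    simp only [ne_eq, not_true_eq_false, false_and, if_false, if_true, one_mul]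
    rw [mul_comm]
    congr 1
    refine Finset.prod_congr rfl fun b hb => ?_
    have := (Finset.mem_erase.1 hb).1
    simp [Ne.symm this]
  refine ⟨fun a c => if O a c then M a * M c else 0, fun a c => ?_, fun a c => ?_,
    fun a b hab => ?_⟩
  · by_cases h : O a c
    · simp [h, hsymm _ _ h, mul_comm]
    · have : ¬ O c a := fun h' => h (hsymm _ _ h')
      simp [h, this]
  · by_cases h : O a c
    · simp [h, hMpos]
    · simp [h]
  · simp only [hrow, hab]

end Weights

section Geometry

open Relation

/-- Length of the prefix of `W b.1` ending at the boundary `b`. -/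
def pos (W : ℕ → List X) (L : X → ℕ) (b : ℕ × ℕ) : ℕ := (((W b.1).take b.2).map L).sum

/-- `b` is a boundary of the pair `(W 1, W 2)`. -/
def IsB (W : ℕ → List X) (b : ℕ × ℕ) : Prop :=
  (b.1 = 1 ∨ b.1 = 2) ∧ 1 ≤ b.2 ∧ b.2 ≤ (W b.1).length

/-- The letter of the segment ending at `b`. -/
def ltr (W : ℕ → List X) (b : ℕ × ℕ) : Option X := (W b.1)[b.2 - 1]?

/-- The segments ending at `a` and `c` lie on opposite sides and overlap. -/
def Overlap (W : ℕ → List X) (L : X → ℕ) (a c : ℕ × ℕ) : Prop :=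
  IsB W a ∧ IsB W c ∧ a.1 ≠ c.1 ∧ pos W L (a.1, a.2 - 1) < pos W L c ∧
    pos W L (c.1, c.2 - 1) < pos W L a

/-- Distinct segments carrying the same letter. -/
def Same (W : ℕ → List X) (a b : ℕ × ℕ) : Prop :=
  IsB W a ∧ IsB W b ∧ a ≠ b ∧ ltr W a = ltr W b

/-- Edge relation of the cut graph determined by a length function. -/
def Edge (W : ℕ → List X) (L : X → ℕ) (a b : ℕ × ℕ) : Prop :=
  ∃ c, Overlap W L a c ∧ Same W c b

/-- Acyclicity of the cut graph determined by a length function. -/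
def SAcyc (W : ℕ → List X) (L : X → ℕ) : Prop := ∀ a, ¬ TransGen (Edge W L) a a

/-- Both sides have the same total length. -/
def Bal (W : ℕ → List X) (L : X → ℕ) : Prop :=
  pos W L (1, (W 1).length) = pos W L (2, (W 2).length)

/-- Positions of the two sides agree at the two ends only. -/
def Stag (W : ℕ → List X) (L : X → ℕ) : Prop :=
  ∀ j k : ℕ, j ≤ (W 1).length → k ≤ (W 2).length → pos W L (1, j) = pos W L (2, k) →
    (j = 0 ∧ k = 0) ∨ (j = (W 1).length ∧ k = (W 2).length)

variable {W : ℕ → List X} {L : X → ℕ}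

lemma Overlap.symm {a c : ℕ × ℕ} (h : Overlap W L a c) : Overlap W L c a :=
  ⟨h.2.1, h.1, h.2.2.1.symm, h.2.2.2.2, h.2.2.2.1⟩

lemma Same.symm {a c : ℕ × ℕ} (h : Same W a c) : Same W c a :=
  ⟨h.2.1, h.1, h.2.2.1.symm, h.2.2.2.symm⟩

@[simp] lemma pos_zero (i : ℕ) : pos W L (i, 0) = 0 := by simp [pos]

lemma pos_succ {i j : ℕ} (h : j < (W i).length) :
    pos W L (i, j + 1) = pos W L (i, j) + L (W i)[j] := by
  simp only [pos]
  rw [List.take_add_one, List.getElem?_eq_getElem h, List.map_append, List.sum_append]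
  simp only [Option.toList_some, List.map_cons, List.map_nil, List.sum_singleton]

lemma pos_pred {b : ℕ × ℕ} {z : X} (h1 : 1 ≤ b.2) (hz : ltr W b = some z) :
    pos W L b = pos W L (b.1, b.2 - 1) + L z := by
  obtain ⟨i, j⟩ := b
  obtain ⟨j, rfl⟩ : ∃ k, j = k + 1 := ⟨j - 1, by simp at h1; omega⟩
  simp only [ltr, Nat.add_sub_cancel] at hz ⊢
  obtain ⟨h, rfl⟩ := List.getElem?_eq_some_iff.1 hz
  exact pos_succ h

lemma exists_ltr {b : ℕ × ℕ} (h : IsB W b) : ∃ z, ltr W b = some z :=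
  ⟨_, List.getElem?_eq_getElem (by have := h.2; omega)⟩

lemma pos_mono {i j k : ℕ} (h : j ≤ k) : pos W L (i, j) ≤ pos W L (i, k) := by
  have : (W i).take j <+: (W i).take k := List.take_prefix_take_left h
  obtain ⟨t, ht⟩ := this
  simp only [pos, ← ht, List.map_append, List.sum_append]
  omega

lemma pos_lt (hL : ∀ z, 0 < L z) {i j k : ℕ} (h : j < k) (hk : k ≤ (W i).length) :
    pos W L (i, j) < pos W L (i, k) := by
  have h1 := pos_succ (W := W) (L := L) (i := i) (j := j) (by omega)
  have h2 := pos_mono (W := W) (L := L) (i := i) (j := j + 1) (k := k) h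
  have := hL (W i)[j]
  omega

lemma lt_of_pos_lt {i j k : ℕ} (h : pos W L (i, j) < pos W L (i, k)) : j < k := by
  by_contra hjk
  have := pos_mono (W := W) (L := L) (i := i) (not_lt.1 hjk)
  omega

lemma locate_left {g : ℕ → ℕ} {n t : ℕ} (h0 : g 0 ≤ t) (hn : t < g n) :
    ∃ k < n, g k ≤ t ∧ t < g (k + 1) := by
  induction n with
  | zero => omega
  | succ n ih =>
    by_cases h : t < g n
    · obtain ⟨k, hk, h⟩ := ih h
      exact ⟨k, by omega, h⟩
    · exact ⟨n, by omega, by omega, hn⟩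

lemma locate_right {g : ℕ → ℕ} {n t : ℕ} (h0 : g 0 < t) (hn : t ≤ g n) :
    ∃ k < n, g k < t ∧ t ≤ g (k + 1) := by
  obtain ⟨k, hk, h1, h2⟩ := locate_left (g := g) (n := n) (t := t - 1) (by omega) (by omega)
  exact ⟨k, hk, by omega, by omega⟩

lemma sum_map_take_eq_sum (L : X → ℕ) (l : List X) (j : ℕ) :
    ((l.take j).map L).sum = ∑ k : Fin l.length, if (k : ℕ) < j then L l[k] else 0 := by
  induction l generalizing j with
  | nil => simp
  | cons a l ih =>
    cases j with
    | zero => simp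
    | succ j =>
      simp only [List.take_succ_cons, List.map_cons, List.sum_cons, ih]
      exact (by simp : _ = _ + _ ).trans (Fin.sum_univ_succ (n := l.length)
        (f := fun k : Fin (l.length + 1) => if (k : ℕ) < j + 1 then L (a :: l)[k] else 0)).symm

lemma pos_eq_sum (i j : ℕ) :
    pos W L (i, j) = ∑ k : Fin (W i).length, if (k : ℕ) < j then L (W i)[k] else 0 := by
  exact sum_map_take_eq_sum L (W i) j

/-- If two positions on opposite sides are adjacent in a staggered configuration with acyclic cut
graph, some length function merges exactly these two positions. -/
lemma exists_merge (hL : ∀ z, 0 < L z) (hac : SAcyc W L)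
    {p q : ℕ} (hpq : p = 1 ∧ q = 2 ∨ p = 2 ∧ q = 1)
    (hbal : pos W L (p, (W p).length) = pos W L (q, (W q).length))
    {j₀ k₀ : ℕ} (hj₀ : j₀ < (W p).length) (hk₀ : k₀ ≤ (W q).length)
    (hk₁ : pos W L (q, k₀) < pos W L (p, j₀ + 1))
    (hj₁ : pos W L (q, k₀ - 1) < pos W L (p, j₀)) (hlt : pos W L (p, j₀) < pos W L (q, k₀)) :
    ∃ K : X → ℕ, (∀ z, 0 < K z) ∧
      pos W K (p, (W p).length) = pos W K (q, (W q).length) ∧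
      pos W K (p, j₀) = pos W K (q, k₀) ∧
      ∀ j k, j ≤ (W p).length → k ≤ (W q).length → ¬ (j = j₀ ∧ k = k₀) →
        (pos W L (p, j) < pos W L (q, k) → pos W K (p, j) < pos W K (q, k)) ∧
        (pos W L (q, k) < pos W L (p, j) → pos W K (q, k) < pos W K (p, j)) := by
  have hne : p ≠ q := by omega
  have hp : p = 1 ∨ p = 2 := by omega
  have hq : q = 1 ∨ q = 2 := by omega
  have hk₀1 : 1 ≤ k₀ := by
    by_contra h
    obtain rfl : k₀ = 0 := by omega
    simp at hlt
  set ψ : Fin (W p).length ⊕ Fin (W q).length → ℕ × ℕ :=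
    Sum.elim (fun i => (p, i + 1)) (fun k => (q, k + 1)) with hψ
  have hψB : ∀ a, IsB W (ψ a) := by
    rintro (i | k)
    · exact ⟨hp, by simp [hψ], by simp [hψ]⟩
    · exact ⟨hq, by simp [hψ], by simp [hψ]⟩
  have hψinj : Function.Injective ψ := by
    rintro (i | k) (i' | k') h <;> simp [hψ] at h ⊢
    · exact Fin.ext h
    · exact hne h.1
    · exact hne h.1.symm
    · exact Fin.ext h
  set O : Fin (W p).length ⊕ Fin (W q).length → Fin (W p).length ⊕ Fin (W q).length → Prop :=
    fun a c => Overlap W L (ψ a) (ψ c) ∧ ¬ (ψ a = (p, j₀ + 1) ∧ ψ c = (q, k₀)) ∧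
      ¬ (ψ c = (p, j₀ + 1) ∧ ψ a = (q, k₀)) with hO
  have hOsymm : ∀ a c, O a c → O c a := fun a c h => ⟨h.1.symm, h.2.2, h.2.1⟩
  have mkO : ∀ (i : Fin (W p).length) (k : Fin (W q).length),
      pos W L (p, i) < pos W L (q, k + 1) → pos W L (q, k) < pos W L (p, i + 1) →
      ¬ ((i : ℕ) = j₀ ∧ (k : ℕ) + 1 = k₀) → O (Sum.inl i) (Sum.inr k) := by
    intro i k h1 h2 h3
    refine ⟨⟨hψB _, hψB _, hne, h1, h2⟩, ?_, ?_⟩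
    · rintro ⟨h4, h5⟩
      simp only [hψ, Sum.elim_inl, Sum.elim_inr, Prod.mk.injEq, true_and] at h4 h5
      exact h3 ⟨by omega, h5⟩
    · rintro ⟨h4, -⟩
      simp only [hψ, Sum.elim_inr, Prod.mk.injEq] at h4
      exact hne h4.1.symm
  have exO : ∀ (i : Fin (W p).length) (k : Fin (W q).length), O (Sum.inl i) (Sum.inr k) →
      pos W L (p, i) < pos W L (q, k + 1) ∧ pos W L (q, k) < pos W L (p, i + 1) ∧
      ¬ ((i : ℕ) = j₀ ∧ (k : ℕ) + 1 = k₀) := by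
    intro i k h
    refine ⟨h.1.2.2.2.1, h.1.2.2.2.2, fun h3 => h.2.1 ⟨?_, ?_⟩⟩
    · simp [hψ, h3.1]
    · simp [hψ, h3.2]
  have hOne : ∀ a, ∃ c, O a c := by
    rintro (i | k)
    · by_cases hi : (i : ℕ) = j₀
      · obtain ⟨k, hk, h1, h2⟩ := locate_right (g := fun k => pos W L (q, k))
          (n := (W q).length) (t := pos W L (p, i + 1))
          (by rw [pos_zero, ← pos_zero (W := W) (L := L) p]; exact pos_lt hL (by omega) (by omega))
          (by rw [← hbal]; exact pos_mono (by omega))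
        refine ⟨Sum.inr ⟨k, hk⟩, mkO _ _ ?_ h1 ?_⟩
        · exact lt_of_lt_of_le (pos_lt hL (by omega) (by omega)) h2
        · rintro ⟨-, h4⟩
          simp only at h4
          rw [h4, hi] at h2
          omega
      · obtain ⟨k, hk, h1, h2⟩ := locate_left (g := fun k => pos W L (q, k))
          (n := (W q).length) (t := pos W L (p, i)) (by simp)
          (by rw [← hbal]; exact pos_lt hL (by omega) le_rfl)
        refine ⟨Sum.inr ⟨k, hk⟩, mkO _ _ h2 ?_ ?_⟩
        · exact lt_of_le_of_lt h1 (pos_lt hL (by omega) (by omega))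
        · rintro ⟨h4, -⟩
          exact hi h4
    · by_cases hk : (k : ℕ) + 1 = k₀
      · obtain ⟨i, hi, h1, h2⟩ := locate_left (g := fun k => pos W L (p, k))
          (n := (W p).length) (t := pos W L (q, k)) (by simp)
          (by rw [hbal]; exact pos_lt hL (by omega) le_rfl)
        refine ⟨Sum.inl ⟨i, hi⟩, hOsymm _ _ (mkO _ _ ?_ h2 ?_)⟩
        · exact lt_of_le_of_lt h1 (pos_lt hL (by omega) (by omega))
        · rintro ⟨h4, -⟩
          simp only at h4
          have : (k : ℕ) = k₀ - 1 := by omega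
          rw [h4, this] at h1
          omega
      · obtain ⟨i, hi, h1, h2⟩ := locate_right (g := fun k => pos W L (p, k))
          (n := (W p).length) (t := pos W L (q, k + 1))
          (by rw [pos_zero, ← pos_zero (W := W) (L := L) q]; exact pos_lt hL (by omega) (by omega))
          (by rw [hbal]; exact pos_mono (by omega))
        refine ⟨Sum.inl ⟨i, hi⟩, hOsymm _ _ (mkO _ _ h1 ?_ ?_)⟩
        · exact lt_of_lt_of_le (pos_lt hL (by omega) (by omega)) h2
        · rintro ⟨-, h4⟩
          exact hk h4
  obtain ⟨f, hfs, hfO, hfl⟩ := exists_weights O hOsymm (fun a => ltr W (ψ a)) hOne (by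
    intro a h
    refine hac (ψ a) (TransGen.lift ψ ?_ _ _ h)
    rintro a b ⟨c, h1, h2, h3⟩
    exact ⟨ψ c, h1.1, hψB _, hψB _, fun h => h2 (hψinj h), h3⟩)
  set K : X → ℕ := fun z =>
    if h : ∃ a, ltr W (ψ a) = some z then ∑ c, f h.choose c else 1 with hK
  have hKa : ∀ a z, ltr W (ψ a) = some z → K z = ∑ c, f a c := by
    intro a z h
    have hex : ∃ a, ltr W (ψ a) = some z := ⟨a, h⟩
    simp only [hK, dif_pos hex]
    exact hfl _ _ (hex.choose_spec.trans h.symm)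
  have hKpos : ∀ z, 0 < K z := by
    intro z
    by_cases h : ∃ a, ltr W (ψ a) = some z
    · obtain ⟨a, ha⟩ := h
      rw [hKa a z ha]
      obtain ⟨c, hc⟩ := hOne a
      exact Finset.sum_pos' (fun _ _ => Nat.zero_le _) ⟨c, Finset.mem_univ _, (hfO a c).1 hc⟩
    · simp only [hK]
      rw [dif_neg h]
      exact Nat.one_pos
  have hf0 : ∀ a c, ¬ O a c → f a c = 0 := fun a c h => by
    have := mt (hfO a c).2 h
    omega
  have hll : ∀ i i', f (Sum.inl i) (Sum.inl i') = 0 := fun i i' =>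
    hf0 _ _ fun h => h.1.2.2.1 rfl
  have hrr : ∀ i i', f (Sum.inr i) (Sum.inr i') = 0 := fun i i' =>
    hf0 _ _ fun h => h.1.2.2.1 rfl
  set F : Fin (W p).length → Fin (W q).length → ℕ := fun i k => f (Sum.inl i) (Sum.inr k) with hF
  have hP : ∀ j, pos W K (p, j) = ∑ i : Fin (W p).length, ∑ k : Fin (W q).length, if (i : ℕ) < j then F i k else 0 := by
    intro j
    rw [pos_eq_sum]
    refine Finset.sum_congr rfl fun i _ => ?_
    split_ifs with h
    · rw [hKa (Sum.inl i) (W p)[i] (by simp [hψ, ltr]), Fintype.sum_sum_type]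
      simp [hll, hF]
    · simp
  have hQ : ∀ j, pos W K (q, j) = ∑ i : Fin (W p).length, ∑ k : Fin (W q).length, if (k : ℕ) < j then F i k else 0 := by
    intro j
    rw [pos_eq_sum, Finset.sum_comm]
    refine Finset.sum_congr rfl fun i _ => ?_
    split_ifs with h
    · rw [hKa (Sum.inr i) (W q)[i] (by simp [hψ, ltr]), Fintype.sum_sum_type]
      simp [hrr, hF, hfs]
    · simp
  have hFO : ∀ i k, F i k ≠ 0 → O (Sum.inl i) (Sum.inr k) := fun i k h => by
    by_contra h'
    exact h (hf0 _ _ h')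
  have le1 : ∀ j k, pos W L (p, j) ≤ pos W L (q, k) → ∀ (i : Fin (W p).length) (l : Fin (W q).length),
      (if (i : ℕ) < j then F i l else 0) ≤ if (l : ℕ) < k then F i l else 0 := by
    intro j k h i l
    by_cases hz : F i l = 0
    · simp [hz]
    · have h2 := (exO i l (hFO i l hz)).2.1
      by_cases hi : (i : ℕ) < j
      · have h3 : pos W L (p, i + 1) ≤ pos W L (p, j) := pos_mono hi
        have : (l : ℕ) < k := lt_of_pos_lt (W := W) (L := L) (i := q) (by omega)
        simp [hi, this]
      · simp [hi]
  have le2 : ∀ j k, pos W L (q, k) ≤ pos W L (p, j) → ∀ (i : Fin (W p).length) (l : Fin (W q).length),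
      (if (l : ℕ) < k then F i l else 0) ≤ if (i : ℕ) < j then F i l else 0 := by
    intro j k h i l
    by_cases hz : F i l = 0
    · simp [hz]
    · have h2 := (exO i l (hFO i l hz)).1
      by_cases hi : (l : ℕ) < k
      · have h3 : pos W L (q, l + 1) ≤ pos W L (q, k) := pos_mono hi
        have : (i : ℕ) < j := lt_of_pos_lt (W := W) (L := L) (i := p) (by omega)
        simp [hi, this]
      · simp [hi]
  refine ⟨K, hKpos, ?_, ?_, ?_⟩
  · rw [hP, hQ]
    exact le_antisymm
      (Finset.sum_le_sum fun i _ => Finset.sum_le_sum fun l _ => le1 _ _ hbal.le i l)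
      (Finset.sum_le_sum fun i _ => Finset.sum_le_sum fun l _ => le2 _ _ hbal.ge i l)
  · rw [hP, hQ]
    refine Finset.sum_congr rfl fun i _ => Finset.sum_congr rfl fun l _ => ?_
    refine le_antisymm (le1 _ _ hlt.le i l) ?_
    by_cases hz : F i l = 0
    · simp [hz]
    obtain ⟨h1, h2, h3⟩ := exO i l (hFO i l hz)
    by_cases hl : (l : ℕ) < k₀
    · have hl' : pos W L (q, l + 1) ≤ pos W L (q, k₀) := pos_mono hl
      have hi' : (i : ℕ) < j₀ + 1 := lt_of_pos_lt (W := W) (L := L) (i := p) (by omega)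
      by_cases hi : (i : ℕ) = j₀
      · exfalso
        have h4 : (l : ℕ) + 1 ≤ k₀ - 1 := by omega
        have h5 := pos_mono (W := W) (L := L) (i := q) h4
        rw [hi] at h1
        omega
      · have : (i : ℕ) < j₀ := by omega
        simp [hl, this]
    · simp [hl]
  · intro j k hj hk hjk
    constructor
    · intro h
      have hjm : j < (W p).length := lt_of_pos_lt (W := W) (L := L) (i := p) (by
        rw [hbal]; exact lt_of_lt_of_le h (pos_mono hk))
      obtain ⟨i, l, hi, hl, ho⟩ : ∃ (i : Fin (W p).length) (l : Fin (W q).length),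
          j ≤ (i : ℕ) ∧ (l : ℕ) < k ∧ O (Sum.inl i) (Sum.inr l) := by
        obtain ⟨l, hl, h1, h2⟩ := locate_left (g := fun k => pos W L (q, k))
          (n := k) (t := pos W L (p, j)) (by simp) h
        by_cases hex : j = j₀ ∧ l + 1 = k₀
        · obtain ⟨i, hi, h3, h4⟩ := locate_right (g := fun k => pos W L (p, k))
            (n := (W p).length) (t := pos W L (q, k)) (by simp only [pos_zero]; omega)
            (by rw [hbal]; exact pos_mono hk)
          have hk1 : k - 1 + 1 = k := by omega
          refine ⟨⟨i, hi⟩, ⟨k - 1, by omega⟩, ?_, by simp only; omega, mkO _ _ ?_ ?_ ?_⟩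
          · have : j < i + 1 :=
              lt_of_pos_lt (W := W) (L := L) (i := p) (lt_of_lt_of_le h h4)
            exact Nat.lt_succ_iff.1 this
          · simpa only [hk1] using h3
          · exact lt_of_lt_of_le (pos_lt hL (show k - 1 < k by omega) hk) h4
          · rintro ⟨-, h5⟩
            simp only at h5
            exact hjk ⟨hex.1, by omega⟩
        · exact ⟨⟨j, hjm⟩, ⟨l, by omega⟩, le_rfl, hl, mkO _ _ h2
            (lt_of_le_of_lt h1 (pos_lt hL (by simp) (by simpa using hjm))) hex⟩
      rw [hP, hQ]
      refine Finset.sum_lt_sum (fun i _ => Finset.sum_le_sum fun l _ => le1 _ _ h.le i l)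
        ⟨i, Finset.mem_univ _, Finset.sum_lt_sum (fun l _ => le1 _ _ h.le i l)
          ⟨l, Finset.mem_univ _, ?_⟩⟩
      rw [if_neg (by omega), if_pos hl]
      exact (hfO _ _).1 ho
    · intro h
      have hkm : k < (W q).length := lt_of_pos_lt (W := W) (L := L) (i := q) (by
        rw [← hbal]; exact lt_of_lt_of_le h (pos_mono hj))
      obtain ⟨i, hi, h1, h2⟩ := locate_left (g := fun k => pos W L (p, k))
        (n := j) (t := pos W L (q, k)) (by simp) h
      have ho : O (Sum.inl ⟨i, by omega⟩) (Sum.inr ⟨k, hkm⟩) := by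
        refine mkO _ _ ?_ h2 ?_
        · exact lt_of_le_of_lt h1 (pos_lt hL (by simp) (by simpa using hkm))
        · rintro ⟨h4, h5⟩
          simp only at h4 h5
          have : k = k₀ - 1 := by omega
          rw [h4, this] at h1
          omega
      rw [hP, hQ]
      refine Finset.sum_lt_sum (fun i _ => Finset.sum_le_sum fun l _ => le2 _ _ h.le i l)
        ⟨⟨i, by omega⟩, Finset.mem_univ _, Finset.sum_lt_sum (fun l _ => le2 _ _ h.le _ l)
          ⟨⟨k, hkm⟩, Finset.mem_univ _, ?_⟩⟩
      rw [if_neg (lt_irrefl k), if_pos hi]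
      exact (hfO _ _).1 ho

end Geometry

section Flip

open Relation

variable {W : ℕ → List X} {L : X → ℕ}

lemma le_pos_length {i : ℕ} {z : X} (hz : z ∈ W i) : L z ≤ pos W L (i, (W i).length) := by
  simp only [pos, List.take_length]
  exact List.single_le_sum (fun _ _ => Nat.zero_le _) _ (List.mem_map_of_mem hz)

/-- Two adjacent positions on opposite sides of a staggered configuration with acyclic cut graph can
be exchanged by changing the length function, without affecting any other comparison. -/
lemma exists_flip (hL : ∀ z, 0 < L z) (hac : SAcyc W L)
    {p q : ℕ} (hpq : p = 1 ∧ q = 2 ∨ p = 2 ∧ q = 1)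
    (hbal : pos W L (p, (W p).length) = pos W L (q, (W q).length))
    {j₀ k₀ : ℕ} (hj₀ : j₀ < (W p).length) (hk₀ : k₀ ≤ (W q).length)
    (hk₁ : pos W L (q, k₀) < pos W L (p, j₀ + 1))
    (hj₁ : pos W L (q, k₀ - 1) < pos W L (p, j₀)) (hlt : pos W L (p, j₀) < pos W L (q, k₀)) :
    ∃ K : X → ℕ, (∀ z, 0 < K z) ∧
      pos W K (p, (W p).length) = pos W K (q, (W q).length) ∧
      pos W K (q, k₀) < pos W K (p, j₀) ∧
      ∀ j k, j ≤ (W p).length → k ≤ (W q).length → ¬ (j = j₀ ∧ k = k₀) →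
        (pos W L (p, j) < pos W L (q, k) → pos W K (p, j) < pos W K (q, k)) ∧
        (pos W L (q, k) < pos W L (p, j) → pos W K (q, k) < pos W K (p, j)) := by
  obtain ⟨K, hK, hKb, hKe, hKo⟩ := exists_merge hL hac hpq hbal hj₀ hk₀ hk₁ hj₁ hlt
  set N := pos W L (p, (W p).length) with hN
  have hLN : ∀ z, z ∈ W p ∨ z ∈ W q → L z ≤ N := by
    rintro z (hz | hz)
    · exact le_pos_length hz
    · rw [hbal]
      exact le_pos_length hz
  set M : X → ℕ := fun z => if z ∈ W p ∨ z ∈ W q then (N + 1) * K z - L z else 1 with hM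
  have hMz : ∀ z, z ∈ W p ∨ z ∈ W q → M z + L z = (N + 1) * K z ∧ 0 < M z := by
    intro z hz
    have h1 := hLN z hz
    have h2 : (N + 1) * 1 ≤ (N + 1) * K z := Nat.mul_le_mul_left _ (hK z)
    simp only [hM, if_pos hz]
    omega
  have hsum : ∀ l : List X, (∀ z ∈ l, z ∈ W p ∨ z ∈ W q) →
      (l.map M).sum + (l.map L).sum = (N + 1) * (l.map K).sum := by
    intro l
    induction l with
    | nil => simp
    | cons a l ih =>
      intro h
      have h1 := ih fun z hz => h z (List.mem_cons_of_mem _ hz)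
      have h2 := (hMz a (h a List.mem_cons_self)).1
      simp only [List.map_cons, List.sum_cons, mul_add]
      omega
  have hp : ∀ j, pos W M (p, j) + pos W L (p, j) = (N + 1) * pos W K (p, j) := fun j =>
    hsum _ fun z hz => Or.inl (List.mem_of_mem_take hz)
  have hq : ∀ j, pos W M (q, j) + pos W L (q, j) = (N + 1) * pos W K (q, j) := fun j =>
    hsum _ fun z hz => Or.inr (List.mem_of_mem_take hz)
  refine ⟨M, ?_, ?_, ?_, ?_⟩
  · intro z
    by_cases hz : z ∈ W p ∨ z ∈ W q
    · exact (hMz z hz).2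
    · simp only [hM, if_neg hz]
      exact Nat.one_pos
  · have h1 := hp (W p).length
    have h2 := hq (W q).length
    rw [hKb] at h1
    omega
  · have h1 := hp j₀
    have h2 := hq k₀
    rw [hKe] at h1
    omega
  · intro j k hj hk hjk
    have h1 := hp j
    have h2 := hq k
    have h3 : pos W L (p, j) ≤ N := pos_mono hj
    have h4 : pos W L (q, k) ≤ N := by
      rw [hbal]
      exact pos_mono hk
    obtain ⟨h5, h6⟩ := hKo j k hj hk hjk
    constructor
    · intro h
      have h7 : (N + 1) * (pos W K (p, j) + 1) ≤ (N + 1) * pos W K (q, k) :=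
        Nat.mul_le_mul_left _ (h5 h)
      rw [mul_add] at h7
      omega
    · intro h
      have h7 : (N + 1) * (pos W K (q, k) + 1) ≤ (N + 1) * pos W K (p, j) :=
        Nat.mul_le_mul_left _ (h6 h)
      rw [mul_add] at h7
      omega

/-- Any arrangement `R` of the inner positions of the two sides compatible with the orders of the
sides is reached from a given one, staying inside a class `Q` of length functions with acyclic cut
graphs which is closed under exchanges that do not destroy agreement with `R`. -/
theorem exists_arrangement (Q : (X → ℕ) → Prop) (R : ℕ → ℕ → Prop)
    (hQ : ∀ L, Q L → (∀ z, 0 < L z) ∧ Bal W L ∧ Stag W L ∧ SAcyc W L)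
    (hR₁ : ∀ j k, 1 ≤ j → j + 1 < (W 1).length → 1 ≤ k → k < (W 2).length → R (j + 1) k → R j k)
    (hR₂ : ∀ j k, 1 ≤ j → j < (W 1).length → 1 ≤ k → k + 1 < (W 2).length → R j k → R j (k + 1))
    (hstep : ∀ L L₂, Q L → (∀ z, 0 < L₂ z) → Bal W L₂ → Stag W L₂ →
      (∀ j k, 1 ≤ j → j < (W 1).length → 1 ≤ k → k < (W 2).length →
        (pos W L (1, j) < pos W L (2, k) ↔ R j k) →
        (pos W L₂ (1, j) < pos W L₂ (2, k) ↔ R j k)) → Q L₂)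
    (L₀ : X → ℕ) (h₀ : Q L₀) :
    ∃ L, Q L ∧ ∀ j k, 1 ≤ j → j < (W 1).length → 1 ≤ k → k < (W 2).length →
      (pos W L (1, j) < pos W L (2, k) ↔ R j k) := by
  set box : Finset (ℕ × ℕ) := Finset.Ico 1 (W 1).length ×ˢ Finset.Ico 1 (W 2).length with hbox
  set inv : (X → ℕ) → Finset (ℕ × ℕ) := fun L =>
    box.filter fun a => ¬ (pos W L (1, a.1) < pos W L (2, a.2) ↔ R a.1 a.2) with hinv
  have memInv : ∀ L j k, (j, k) ∈ inv L ↔ (1 ≤ j ∧ j < (W 1).length ∧ 1 ≤ k ∧ k < (W 2).length) ∧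
      ¬ (pos W L (1, j) < pos W L (2, k) ↔ R j k) := by
    intro L j k
    simp only [hinv, hbox, Finset.mem_filter, Finset.mem_product, Finset.mem_Ico]
    tauto
  have fin : ∀ L L₂ j₀ k₀, Q L → (j₀, k₀) ∈ inv L → (∀ z, 0 < L₂ z) → Bal W L₂ →
      pos W L (1, j₀) ≠ pos W L (2, k₀) →
      (pos W L (1, j₀) < pos W L (2, k₀) → pos W L₂ (2, k₀) < pos W L₂ (1, j₀)) →
      (pos W L (2, k₀) < pos W L (1, j₀) → pos W L₂ (1, j₀) < pos W L₂ (2, k₀)) →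
      (∀ j k, j ≤ (W 1).length → k ≤ (W 2).length → ¬ (j = j₀ ∧ k = k₀) →
        (pos W L (1, j) < pos W L (2, k) → pos W L₂ (1, j) < pos W L₂ (2, k)) ∧
        (pos W L (2, k) < pos W L (1, j) → pos W L₂ (2, k) < pos W L₂ (1, j))) →
      Q L₂ ∧ inv L₂ ⊂ inv L := by
    intro L L₂ j₀ k₀ hL hin hpos hbal hne h1 h2 h3
    have hst := (hQ L hL).2.2.1
    have hst₂ : Stag W L₂ := by
      intro j k hj hk h
      by_cases hjk : j = j₀ ∧ k = k₀
      · obtain ⟨rfl, rfl⟩ := hjk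
        rcases lt_or_gt_of_ne hne with h' | h'
        · have := h1 h'
          omega
        · have := h2 h'
          omega
      · obtain ⟨h4, h5⟩ := h3 j k hj hk hjk
        refine hst j k hj hk ?_
        by_contra h6
        rcases lt_or_gt_of_ne h6 with h' | h'
        · have := h4 h'
          omega
        · have := h5 h'
          omega
    have hagree : ∀ j k, 1 ≤ j → j < (W 1).length → 1 ≤ k → k < (W 2).length →
        ¬ (j = j₀ ∧ k = k₀) →
        (pos W L₂ (1, j) < pos W L₂ (2, k) ↔ pos W L (1, j) < pos W L (2, k)) := by
      intro j k hj hj' hk hk' hjk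
      obtain ⟨h4, h5⟩ := h3 j k hj'.le hk'.le hjk
      refine ⟨fun h => ?_, h4⟩
      by_contra h6
      rcases lt_or_eq_of_le (not_lt.1 h6) with h' | h'
      · have := h5 h'
        omega
      · have := hst j k hj'.le hk'.le h'.symm
        omega
    have hj₀ := (memInv _ _ _).1 hin
    have hflip : pos W L₂ (1, j₀) < pos W L₂ (2, k₀) ↔ R j₀ k₀ := by
      have h6 := hj₀.2
      rcases lt_or_gt_of_ne hne with h' | h'
      · have h7 := h1 h'
        have h8 : ¬ R j₀ k₀ := fun h => h6 ⟨fun _ => h, fun _ => h'⟩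
        exact ⟨fun h => absurd h (by omega), fun h => absurd h h8⟩
      · have h7 := h2 h'
        have h8 : R j₀ k₀ := by
          by_contra h
          exact h6 ⟨fun h9 => absurd h9 (by omega), fun h9 => absurd h9 h⟩
        exact ⟨fun _ => h8, fun _ => h7⟩
    refine ⟨hstep L L₂ hL hpos hbal hst₂ ?_, ?_⟩
    · intro j k hj hj' hk hk' h
      by_cases hjk : j = j₀ ∧ k = k₀
      · rw [hjk.1, hjk.2]
        exact hflip
      · exact (hagree j k hj hj' hk hk' hjk).trans h
    · refine Finset.ssubset_iff_subset_ne.2 ⟨?_, ?_⟩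
      · rintro ⟨j, k⟩ h
        obtain ⟨⟨hj, hj', hk, hk'⟩, h⟩ := (memInv _ _ _).1 h
        have hjk : ¬ (j = j₀ ∧ k = k₀) := by
          rintro ⟨rfl, rfl⟩
          exact h hflip
        exact (memInv _ _ _).2
          ⟨⟨hj, hj', hk, hk'⟩, fun h' => h ((hagree j k hj hj' hk hk' hjk).trans h')⟩
      · intro h
        rw [← h] at hin
        exact ((memInv _ _ _).1 hin).2 hflip
  obtain ⟨n, hn⟩ : ∃ n, (inv L₀).card = n := ⟨_, rfl⟩
  induction n using Nat.strong_induction_on generalizing L₀ with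
  | _ n ih =>
  by_cases he : inv L₀ = ∅
  · refine ⟨L₀, h₀, fun j k hj hj' hk hk' => ?_⟩
    by_contra h
    have := (memInv L₀ j k).2 ⟨⟨hj, hj', hk, hk'⟩, h⟩
    simp [he] at this
  obtain ⟨hpos, hbal, hst, hac⟩ := hQ L₀ h₀
  obtain ⟨⟨j, k⟩, hjk, hmin⟩ := Finset.exists_min_image (inv L₀)
    (fun a => (pos W L₀ (1, a.1) - pos W L₀ (2, a.2)) + (pos W L₀ (2, a.2) - pos W L₀ (1, a.1)))
    (Finset.nonempty_iff_ne_empty.2 he)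
  have hmin' : ∀ j' k', (j', k') ∈ inv L₀ →
      (pos W L₀ (1, j) - pos W L₀ (2, k)) + (pos W L₀ (2, k) - pos W L₀ (1, j)) ≤
      (pos W L₀ (1, j') - pos W L₀ (2, k')) + (pos W L₀ (2, k') - pos W L₀ (1, j')) :=
    fun j' k' h => hmin _ h
  obtain ⟨⟨hj, hj', hk, hk'⟩, hne⟩ := (memInv _ _ _).1 hjk
  have hposne : pos W L₀ (1, j) ≠ pos W L₀ (2, k) := fun h => by
    have := hst j k hj'.le hk'.le h
    omega
  suffices h : ∃ L₂, Q L₂ ∧ inv L₂ ⊂ inv L₀ by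
    obtain ⟨L₂, h1, h2⟩ := h
    exact ih _ (by rw [← hn]; exact Finset.card_lt_card h2) L₂ h1 rfl
  rcases lt_or_gt_of_ne hposne with hlt | hlt
  · have hnR : ¬ R j k := fun h => hne ⟨fun _ => h, fun _ => hlt⟩
    have ha : pos W L₀ (2, k) < pos W L₀ (1, j + 1) := by
      by_contra h
      have hj1 : j + 1 < (W 1).length := by
        refine lt_of_pos_lt (W := W) (L := L₀) (i := 1) (lt_of_le_of_lt (not_lt.1 h) ?_)
        rw [hbal]
        exact pos_lt hpos hk' le_rfl
      have hlt' : pos W L₀ (1, j + 1) < pos W L₀ (2, k) :=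
        lt_of_le_of_ne (not_lt.1 h) fun h => by
          have := hst (j + 1) k hj1.le hk'.le h
          omega
      have h1 := hmin' (j + 1) k ((memInv _ _ _).2 ⟨⟨by omega, hj1, hk, hk'⟩,
        fun h => hnR (hR₁ j k hj hj1 hk hk' (h.1 hlt'))⟩)
      have h2 : pos W L₀ (1, j) < pos W L₀ (1, j + 1) := pos_lt hpos (by omega) hj1.le
      omega
    have hb : pos W L₀ (2, k - 1) < pos W L₀ (1, j) := by
      by_contra h
      have hk1 : 1 ≤ k - 1 := by
        refine lt_of_pos_lt (W := W) (L := L₀) (i := 2) (lt_of_lt_of_le ?_ (not_lt.1 h))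
        rw [pos_zero, ← pos_zero (W := W) (L := L₀) 1]
        exact pos_lt hpos hj hj'.le
      have hlt' : pos W L₀ (1, j) < pos W L₀ (2, k - 1) :=
        lt_of_le_of_ne (not_lt.1 h) fun h => by
          have := hst j (k - 1) hj'.le (by omega) h
          omega
      have h1 := hmin' j (k - 1) ((memInv _ _ _).2 ⟨⟨hj, hj', hk1, by omega⟩, fun h => hnR (by
        have := hR₂ j (k - 1) hj hj' hk1 (by omega) (h.1 hlt')
        rwa [show k - 1 + 1 = k by omega] at this)⟩)
      have h2 : pos W L₀ (2, k - 1) < pos W L₀ (2, k) := pos_lt hpos (by omega) hk'.le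
      omega
    obtain ⟨K, h1, h2, h3, h4⟩ :=
      exists_flip hpos hac (Or.inl ⟨rfl, rfl⟩) hbal hj' hk'.le ha hb hlt
    exact ⟨K, fin L₀ K j k h₀ hjk h1 h2 hposne (fun _ => h3) (fun h => absurd h (by omega)) h4⟩
  · have hyR : R j k := by
      by_contra h
      exact hne ⟨fun h9 => absurd h9 (by omega), fun h9 => absurd h9 h⟩
    have ha : pos W L₀ (1, j) < pos W L₀ (2, k + 1) := by
      by_contra h
      have hk1 : k + 1 < (W 2).length := by
        refine lt_of_pos_lt (W := W) (L := L₀) (i := 2) (lt_of_le_of_lt (not_lt.1 h) ?_)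
        rw [← hbal]
        exact pos_lt hpos hj' le_rfl
      have hlt' : pos W L₀ (2, k + 1) < pos W L₀ (1, j) :=
        lt_of_le_of_ne (not_lt.1 h) fun h => by
          have := hst j (k + 1) hj'.le hk1.le h.symm
          omega
      have h1 := hmin' j (k + 1) ((memInv _ _ _).2 ⟨⟨hj, hj', by omega, hk1⟩,
        fun h => absurd (h.2 (hR₂ j k hj hj' hk hk1 hyR)) (by omega)⟩)
      have h2 : pos W L₀ (2, k) < pos W L₀ (2, k + 1) := pos_lt hpos (by omega) hk1.le
      omega
    have hb : pos W L₀ (1, j - 1) < pos W L₀ (2, k) := by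
      by_contra h
      have hj1 : 1 ≤ j - 1 := by
        refine lt_of_pos_lt (W := W) (L := L₀) (i := 1) (lt_of_lt_of_le ?_ (not_lt.1 h))
        rw [pos_zero, ← pos_zero (W := W) (L := L₀) 2]
        exact pos_lt hpos hk hk'.le
      have hlt' : pos W L₀ (2, k) < pos W L₀ (1, j - 1) :=
        lt_of_le_of_ne (not_lt.1 h) fun h => by
          have := hst (j - 1) k (by omega) hk'.le h.symm
          omega
      have h1 := hmin' (j - 1) k ((memInv _ _ _).2 ⟨⟨hj1, by omega, hk, hk'⟩,
        fun h => absurd (h.2 (hR₁ (j - 1) k hj1 (by omega) hk hk' (by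
          rwa [show j - 1 + 1 = j by omega]))) (by omega)⟩)
      have h2 : pos W L₀ (1, j - 1) < pos W L₀ (1, j) := pos_lt hpos (by omega) hj'.le
      omega
    obtain ⟨K, h1, h2, h3, h4⟩ :=
      exists_flip hpos hac (Or.inr ⟨rfl, rfl⟩) hbal.symm hk' hj'.le ha hb hlt
    exact ⟨K, fin L₀ K j k h₀ hjk h1 h2.symm hposne (fun h => absurd h (by omega)) (fun _ => h3)
      fun j' k' h5 h6 h7 => (h4 k' j' h6 h5 (by tauto)).symm⟩

end Flip

section Cycles

open Relation

/-- `a → b` if `a` overlaps something that is mirrored at `b`. -/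
def Step {α : Type*} (O S : α → α → Prop) (a b : α) : Prop := ∃ c, O a c ∧ S c b

/-- A periodic alternating sequence `w k`, `c k`, `w (k + 1)`, … of overlaps and mirrors. -/
def Periodic {α : Type*} (O S : α → α → Prop) (n : ℕ) (w c : ℤ → α) : Prop :=
  0 < n ∧ ∀ k, O (w k) (c k) ∧ S (c k) (w (k + 1)) ∧ w (k + n) = w k ∧ c (k + n) = c k

/-- `n` is the length of some closed walk for `Step O S`. -/
def HasLoop {α : Type*} (O S : α → α → Prop) (n : ℕ) : Prop :=
  0 < n ∧ ∃ w : ℕ → α, w n = w 0 ∧ ∀ k < n, Step O S (w k) (w (k + 1))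

variable {α β : Type*} {O S : α → α → Prop} {n : ℕ} {w c : ℤ → α}

lemma exists_walk_of_transGen {r : α → α → Prop} {a b : α} (h : TransGen r a b) :
    ∃ n, 0 < n ∧ ∃ w : ℕ → α, w 0 = a ∧ w n = b ∧ ∀ k < n, r (w k) (w (k + 1)) := by
  induction h with
  | @single b hb =>
    refine ⟨1, one_pos, fun k => if k = 0 then a else b, rfl, rfl, fun k hk => ?_⟩
    obtain rfl : k = 0 := by omega
    exact hb
  | @tail b c _ hbc ih =>
    obtain ⟨n, hn, w, h0, h1, h2⟩ := ih
    refine ⟨n + 1, by omega, fun k => if k ≤ n then w k else c, by simp [h0], by simp, ?_⟩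
    intro k hk
    by_cases hkn : k = n
    · subst hkn
      simpa [h1] using hbc
    · have h3 : k + 1 ≤ n := by omega
      have h4 : k ≤ n := by omega
      simpa only [if_pos h3, if_pos h4] using h2 k (by omega)

lemma transGen_of_walk {r : α → α → Prop} {w : ℕ → α} {n : ℕ} (hn : 0 < n)
    (h : ∀ k < n, r (w k) (w (k + 1))) : TransGen r (w 0) (w n) := by
  induction n with
  | zero => omega
  | succ n ih =>
    by_cases hn : n = 0
    · subst hn
      exact TransGen.single (h 0 one_pos)
    · exact (ih (by omega) fun k hk => h k (by omega)).tail (h n (by omega))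

lemma reflTransGen_of_int {r : α → α → Prop} {w : ℤ → α} {a b : ℤ} (hab : a ≤ b)
    (h : ∀ k, a ≤ k → k < b → r (w k) (w (k + 1))) : ReflTransGen r (w a) (w b) := by
  induction b, hab using Int.leInduction with
  | base => exact ReflTransGen.refl
  | succ b hb ih =>
    exact (ih fun k h1 h2 => h k h1 (by omega)).tail (h b hb (by omega))

/-- Walks can be traversed backwards. -/
lemma exists_reverse (hO : ∀ a b, O a b → O b a) (hS : ∀ a b, S a b → S b a) {a a' b : α}
    (h : S a a') (hw : ReflTransGen (Step O S) a' b) :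
    ∃ b', S b b' ∧ ReflTransGen (Step O S) b' a := by
  induction hw with
  | refl => exact ⟨a, hS _ _ h, ReflTransGen.refl⟩
  | @tail b b₂ _ hb ih =>
    obtain ⟨b', h1, h2⟩ := ih
    obtain ⟨c, h3, h4⟩ := hb
    exact ⟨c, hS _ _ h4, ReflTransGen.head ⟨b, hO _ _ h3, h1⟩ h2⟩

lemma Periodic.rotate (h : Periodic O S n w c) (t : ℤ) :
    Periodic O S n (fun k => w (k + t)) (fun k => c (k + t)) := by
  refine ⟨h.1, fun k => ?_⟩
  obtain ⟨h1, h2, h3, h4⟩ := h.2 (k + t)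
  simp only
  rw [show k + 1 + t = k + t + 1 by ring, show k + n + t = k + t + n by ring]
  exact ⟨h1, h2, h3, h4⟩

lemma Periodic.reverse (hO : ∀ a b, O a b → O b a) (hS : ∀ a b, S a b → S b a)
    (h : Periodic O S n w c) : Periodic O S n (fun k => c (-k)) (fun k => w (-k)) := by
  refine ⟨h.1, fun k => ?_⟩
  have h1 := (h.2 (-k)).1
  have h2 := (h.2 (-(k + 1))).2.1
  have h3 := (h.2 (-(k + n))).2.2
  rw [show -(k + 1) + 1 = -k by ring] at h2
  rw [show -(k + n) + n = -k by ring] at h3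
  exact ⟨hO _ _ h1, hS _ _ h2, h3.2.symm, h3.1.symm⟩

lemma HasLoop.exists_periodic (h : HasLoop O S n) : ∃ w c, Periodic O S n w c := by
  obtain ⟨hn, w, h0, h1⟩ := h
  have h1' : ∀ k : Fin n, Step O S (w k) (w (k + 1)) := fun k => h1 k k.2
  choose c hc using h1'
  have hr : ∀ k : ℤ, (k % n).toNat < n := fun k => by
    have h2 := Int.emod_nonneg k (b := n) (by omega)
    have h3 := Int.emod_lt_of_pos k (b := n) (by omega)
    omega
  refine ⟨fun k => w (k % n).toNat, fun k => c ⟨(k % n).toNat, hr k⟩, hn, fun k => ?_⟩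
  obtain ⟨h2, h3⟩ := hc ⟨(k % n).toNat, hr k⟩
  refine ⟨h2, ?_, by simp, by simp⟩
  convert h3 using 1
  have h4 := Int.emod_nonneg k (b := n) (by omega)
  have h5 := Int.emod_lt_of_pos k (b := n) (by omega)
  simp only
  rw [← Int.emod_add_emod]
  by_cases h6 : k % n + 1 = n
  · rw [h6, Int.emod_self, show (k % n).toNat + 1 = n by omega, h0]
    rfl
  · rw [Int.emod_eq_of_lt (by omega) (by omega),
      show (k % n + 1).toNat = (k % n).toNat + 1 by omega]

lemma Periodic.le_of_chord (h : Periodic O S n w c) (hmin : ∀ m, HasLoop O S m → n ≤ m)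
    {a b : ℤ} (hab : a ≤ b) (he : Step O S (w b) (w a)) : (n : ℤ) ≤ b - a + 1 := by
  have := hmin (b - a + 1).toNat ⟨by omega,
    fun t => if (t : ℤ) ≤ b - a then w (a + t) else w a, ?_, fun k hk => ?_⟩
  · omega
  · simp only
    rw [if_neg (by omega), if_pos (by simp; omega)]
    simp
  · have h1 : (k : ℤ) ≤ b - a := by omega
    simp only [if_pos h1]
    split_ifs with h2
    · have := h.2 (a + k)
      push_cast
      rw [← add_assoc]
      exact ⟨_, this.1, this.2.1⟩
    · rwa [show a + (k : ℤ) = b by push_cast at h2; omega]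

lemma Periodic.chordless (h : Periodic O S n w c) (hmin : ∀ m, HasLoop O S m → n ≤ m)
    {k l : ℤ} (hk : 0 ≤ k) (hk' : k < n) (hl : 0 ≤ l) (hl' : l < n)
    (he : Step O S (w k) (w (l + 1))) : k = l := by
  rcases lt_trichotomy k l with hlt | heq | hlt
  · have := h.le_of_chord hmin (a := l + 1) (b := k + n) (by omega)
      (by rwa [(h.2 k).2.2.1])
    omega
  · exact heq
  · have := h.le_of_chord hmin (a := l + 1) (b := k) (by omega) he
    omega

/-- Transfer of acyclicity along a splitting of the vertices `c` with `isX c` into `main c` and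
`mid c`, where `y₀` disappears, provided that the position of the `mid c` can be adjusted by a
threshold `θ`. -/
theorem acyclic_of_split (hOs : ∀ a b, O a b → O b a) (hSs : ∀ a b, S a b → S b a)
    (hOne : ∀ a, ¬ O a a) (hSne : ∀ a b, S a b → a ≠ b) {isX isY : α → Prop}
    (hSX : ∀ a b, S a b → isX a → isX b) (hSY : ∀ a b, S a b → isY a → isY b)
    (hXS : ∀ a b, isX a → isX b → a ≠ b → S a b)
    {x₀ y₀ : α} (hx₀ : isX x₀) (hy₀ : isY y₀) (hy₀' : ¬ isX y₀) (hOy : ∀ a, O a y₀ → a = x₀)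
    {main mid : α → β} {S' : β → β → Prop} (hS's : ∀ a b, S' a b → S' b a)
    (hS₁ : ∀ a b, S a b → a ≠ y₀ → b ≠ y₀ → S' (main a) (main b))
    (hS₂ : ∀ c b, isX c → c ≠ x₀ → isY b → b ≠ y₀ → S' (mid c) (main b))
    {lo hi : α → ℕ} (hlo : ∀ a b, O a b → a ≠ y₀ → lo a < hi a)
    (hT : ∀ θ : ℕ, ∃ O' : β → β → Prop, (∀ a b, O' a b → O' b a) ∧
      (∀ b, ¬ TransGen (Step O' S') b b) ∧
      (∀ a c, O a c → a ≠ y₀ → c ≠ y₀ → (¬ isX a ∨ a = x₀ ∨ θ < 2 * hi c) →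
        (¬ isX c ∨ c = x₀ ∨ θ < 2 * hi a) → O' (main a) (main c)) ∧
      (∀ a c, O a c → isX c → c ≠ x₀ → a ≠ y₀ → ¬ isX a → 2 * lo a < θ → O' (main a) (mid c))) :
    ∀ a, ¬ TransGen (Step O S) a a := by
  intro a₀ ha₀
  have hex : ∃ n, HasLoop O S n := by
    obtain ⟨n, hn, w, h0, h1, h2⟩ := exists_walk_of_transGen ha₀
    exact ⟨n, hn, w, h1.trans h0.symm, h2⟩
  obtain ⟨n, hloop, hmin⟩ : ∃ n, HasLoop O S n ∧ ∀ m, HasLoop O S m → n ≤ m :=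
    ⟨Nat.find hex, Nat.find_spec hex, fun m hm => Nat.find_min' hex hm⟩
  obtain ⟨w, c, hwc⟩ := hloop.exists_periodic
  have hOy' : ∀ a, O y₀ a → a = x₀ := fun a h => hOy a (hOs _ _ h)
  by_cases hclean : ∀ k, w k ≠ y₀ ∧ c k ≠ y₀
  · obtain ⟨O', -, hac, hT₁, -⟩ := hT 0
    have hp : TransGen (Step O' S') (main (w 0)) (main (w (n : ℕ))) := by
      refine transGen_of_walk (w := fun k : ℕ => main (w k)) hwc.1 fun k _ => ?_
      obtain ⟨h1, h2, -⟩ := hwc.2 k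
      have h3 := hlo _ _ h1 (hclean k).1
      have h4 := hlo _ _ (hOs _ _ h1) (hclean k).2
      push_cast
      exact ⟨main (c k), hT₁ _ _ h1 (hclean k).1 (hclean k).2 (Or.inr (Or.inr (by omega)))
        (Or.inr (Or.inr (by omega))), hS₁ _ _ h2 (hclean k).2 (hclean _).1⟩
    have hwn := (hwc.2 0).2.2.1
    rw [zero_add] at hwn
    rw [hwn] at hp
    exact hac _ hp
  obtain ⟨w, c, hwc, hw0, hc0⟩ : ∃ w c, Periodic O S n w c ∧ w 0 = x₀ ∧ c 0 = y₀ := by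
    have key : ∀ w c, Periodic O S n w c → ∀ k, c k = y₀ →
        ∃ w c, Periodic O S n w c ∧ w 0 = x₀ ∧ c 0 = y₀ := by
      intro w c hwc k hk
      refine ⟨_, _, hwc.rotate k, ?_, ?_⟩
      · simp only [zero_add]
        exact hOy _ (hk ▸ (hwc.2 k).1)
      · simpa using hk
    push Not at hclean
    obtain ⟨k, hk⟩ := hclean
    by_cases h : w k = y₀
    · exact key _ _ (hwc.reverse hOs hSs) (-k) (by simpa using h)
    · exact key _ _ hwc k (hk h)
  have hchord : ∀ k l : ℤ, 0 ≤ k → k < n → 0 ≤ l → l < n → Step O S (w k) (w (l + 1)) → k = l :=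
    fun k l h1 h2 h3 h4 => hwc.chordless hmin h1 h2 h3 h4
  have hO : ∀ k, O (w k) (c k) := fun k => (hwc.2 k).1
  have hS : ∀ k, S (c k) (w (k + 1)) := fun k => (hwc.2 k).2.1
  have hw1 : w 1 ≠ y₀ := fun h => hSne _ _ (hS 0) (by rw [hc0, zero_add, h])
  have hYw1 : isY (w 1) := by
    have := hSY _ _ (hS 0) (by rwa [hc0])
    rwa [zero_add] at this
  have hwn : w n = x₀ := by
    have := (hwc.2 0).2.2.1
    rwa [zero_add, hw0] at this
  have hn0 := hwc.1
  have hn1 : w ((n : ℤ) - 1 + 1) = x₀ := by rwa [sub_add_cancel]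
  have hcx : c (n - 1) ≠ x₀ := fun h => hSne _ _ (hS (n - 1)) (by rw [h, hn1])
  have hcX : isX (c (n - 1)) := hSX _ _ (hSs _ _ (hS (n - 1))) (by rwa [hn1])
  have hn2 : 2 ≤ n := by
    by_contra h
    obtain rfl : n = 1 := by omega
    simp [hc0] at hcX
    exact hy₀' hcX
  have hcXi : ∀ i : ℤ, 0 ≤ i → i < n → isX (c i) → c i ≠ x₀ → i = n - 1 := by
    intro i h1 h2 h3 h4
    refine hchord i (n - 1) h1 h2 (by omega) (by omega) ⟨c i, hO i, ?_⟩
    rw [hn1]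
    exact hXS _ _ h3 hx₀ h4
  have hcj : ∀ j : ℤ, 0 ≤ j → j < n → c j = x₀ → w (j + 1) = c (n - 1) := by
    intro j h1 h2 h3
    by_contra h4
    have h5 := hchord (n - 1) j (by omega) (by omega) h1 h2 ⟨_, hO (n - 1),
      hXS _ _ hcX (hSX _ _ (hS j) (by rwa [h3])) (Ne.symm h4)⟩
    rw [← h5] at h3
    exact hcx h3
  have hcu : ∀ i j : ℤ, 0 ≤ i → i < n → 0 ≤ j → j < n → c i = c j → i = j := by
    intro i j h1 h2 h3 h4 h5
    exact hchord i j h1 h2 h3 h4 ⟨c i, hO i, h5 ▸ hS j⟩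
  have hcy : ∀ i : ℤ, 1 ≤ i → i < n → c i ≠ y₀ := fun i h1 h2 h3 => by
    have := hcu i 0 (by omega) h2 le_rfl (by omega) (by rw [h3, hc0])
    omega
  have hwX : ∀ i : ℤ, 1 ≤ i → i < n → isX (w i) → c (i - 1) = x₀ := by
    intro i h1 h2 h3
    by_contra h4
    have h5 := hSs _ _ (hS (i - 1))
    rw [sub_add_cancel] at h5
    have := hcXi (i - 1) (by omega) (by omega) (hSX _ _ h5 h3) h4
    omega
  have hwy : ∀ i : ℤ, w i = y₀ → c i = x₀ := fun i h => hOy' _ (h ▸ hO i)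
  have hwloop : w (n - 1) ≠ c (n - 1) := fun h => hOne _ (h ▸ hO (n - 1))
  -- edges not touching the split vertices
  have hstep : ∀ (θ : ℕ) (O' : β → β → Prop), (∀ a c, O a c → a ≠ y₀ → c ≠ y₀ →
      (¬ isX a ∨ a = x₀ ∨ θ < 2 * hi c) →
        (¬ isX c ∨ c = x₀ ∨ θ < 2 * hi a) → O' (main a) (main c)) →
      ∀ a b : ℤ, 1 ≤ a → a ≤ b → b ≤ n - 1 → (∀ k, a ≤ k → k < b → c k ≠ x₀) →
      (∀ k, a ≤ k → k ≤ b → w k ≠ y₀) → (∀ k, a ≤ k → k < b → ¬ isX (w k)) →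
      ReflTransGen (Step O' S') (main (w a)) (main (w b)) := by
    intro θ O' hT₁ a b h1 h2 h3 h4 h5 h6
    refine reflTransGen_of_int (w := fun k => main (w k)) h2 fun k hk hk' => ?_
    have hnX : ¬ isX (c k) := fun h => by
      have := hcXi k (by omega) (by omega) h (h4 k hk hk')
      omega
    exact ⟨main (c k), hT₁ _ _ (hO k) (h5 k hk hk'.le) (hcy k (by omega) (by omega))
      (Or.inl (h6 k hk hk')) (Or.inl hnX),
      hS₁ _ _ (hS k) (hcy k (by omega) (by omega)) (h5 _ (by omega) (by omega))⟩
  have hmid1 : S' (mid (c (n - 1))) (main (w 1)) := hS₂ _ _ hcX hcx hYw1 hw1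
  by_cases hj : ∃ j : ℤ, 0 ≤ j ∧ j < n ∧ c j = x₀
  swap
  · have hnx : ∀ k : ℤ, 0 ≤ k → k < n → c k ≠ x₀ := fun k h1 h2 h3 => hj ⟨k, h1, h2, h3⟩
    have hny : ∀ k : ℤ, 0 ≤ k → k < n → w k ≠ y₀ := fun k h1 h2 h3 => hnx k h1 h2 (hwy k h3)
    have hnX : ∀ k : ℤ, 1 ≤ k → k < n → ¬ isX (w k) := fun k h1 h2 h3 =>
      hnx (k - 1) (by omega) (by omega) (hwX k h1 h2 h3)
    obtain ⟨O', -, hac, hT₁, hT₂⟩ := hT (2 * lo (w (n - 1)) + 1)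
    refine hac (main (w (n - 1))) (TransGen.head' ⟨mid (c (n - 1)), hT₂ _ _ (hO _) hcX hcx
      (hny _ (by omega) (by omega)) (hnX _ (by omega) (by omega)) (by omega), hmid1⟩ ?_)
    exact hstep _ O' hT₁ 1 (n - 1) le_rfl (by omega) le_rfl (fun k _ _ => hnx k (by omega) (by omega))
      (fun k _ _ => hny k (by omega) (by omega)) (fun k _ _ => hnX k (by omega) (by omega))
  obtain ⟨j, hj0, hjn, hcjx⟩ := hj
  have hwj1 := hcj j hj0 hjn hcjx
  have hxy : x₀ ≠ y₀ := fun h => hy₀' (h ▸ hx₀)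
  have hj1 : 1 ≤ j := by
    by_contra h
    obtain rfl : j = 0 := by omega
    exact hxy (hcjx.symm.trans hc0)
  have hj3 : j ≤ n - 3 := by
    by_contra h
    rcases (by omega : j = n - 1 ∨ j = n - 2) with rfl | rfl
    · exact hcx hcjx
    · rw [show (n : ℤ) - 2 + 1 = n - 1 by ring] at hwj1
      exact hwloop hwj1
  have hju : ∀ k : ℤ, 0 ≤ k → k < n → k ≠ j → c k ≠ x₀ := fun k h1 h2 h3 h4 =>
    h3 (hcu k j h1 h2 hj0 hjn (h4.trans hcjx.symm))
  have hny : ∀ k : ℤ, 0 ≤ k → k < n → k ≠ j → w k ≠ y₀ := fun k h1 h2 h3 h4 =>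
    hju k h1 h2 h3 (hwy k h4)
  have hnX : ∀ k : ℤ, 1 ≤ k → k < n → k ≠ j + 1 → ¬ isX (w k) := fun k h1 h2 h3 h4 =>
    hju (k - 1) (by omega) (by omega) (by omega) (hwX k h1 h2 h4)
  have hcy₀ : c (n - 1) ≠ y₀ := hcy _ (by omega) (by omega)
  -- the segment overlapping `c (n - 1) = w (j + 1)` next on the walk
  have hOd : O (c (j + 1)) (c (n - 1)) := hOs _ _ (hwj1 ▸ hO (j + 1))
  have hdy : c (j + 1) ≠ y₀ := hcy _ (by omega) (by omega)
  have hdX : ¬ isX (c (j + 1)) := fun h => by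
    have := hcXi (j + 1) (by omega) (by omega) h (hju _ (by omega) (by omega) (by omega))
    omega
  have hSd : S (c (j + 1)) (w (j + 2)) := by
    have := hS (j + 1)
    rwa [add_assoc, one_add_one_eq_two] at this
  have hSd' : S' (main (c (j + 1))) (main (w (j + 2))) :=
    hS₁ _ _ hSd hdy (hny _ (by omega) (by omega) (by omega))
  have hwy' : w (n - 1) ≠ y₀ := hny _ (by omega) (by omega) (by omega)
  have hwX' : ¬ isX (w (n - 1)) := hnX _ (by omega) (by omega) (by omega)
  have hlast : ∀ (θ : ℕ) (O' : β → β → Prop), (∀ a c, O a c → a ≠ y₀ → c ≠ y₀ →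
      (¬ isX a ∨ a = x₀ ∨ θ < 2 * hi c) →
        (¬ isX c ∨ c = x₀ ∨ θ < 2 * hi a) → O' (main a) (main c)) →
      ReflTransGen (Step O' S') (main (w (j + 2))) (main (w (n - 1))) := fun θ O' hT₁ =>
    hstep θ O' hT₁ (j + 2) (n - 1) (by omega) (by omega) le_rfl
      (fun k _ _ => hju k (by omega) (by omega) (by omega))
      (fun k _ _ => hny k (by omega) (by omega) (by omega))
      (fun k _ _ => hnX k (by omega) (by omega) (by omega))
  by_cases hwjy : w j = y₀
  · have hSj : S (c (j - 1)) y₀ := by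
      have := hS (j - 1)
      rwa [sub_add_cancel, hwjy] at this
    have hcj1 : c (j - 1) ≠ y₀ := hSne _ _ hSj
    have hj2 : 2 ≤ j := by
      by_contra h
      obtain rfl : j = 1 := by omega
      exact hcj1 (by simpa using hc0)
    have hcj1X : ¬ isX (c (j - 1)) := fun h => hy₀' (hSX _ _ hSj h)
    obtain ⟨O', hO's, hac, hT₁, hT₂⟩ :=
      hT (2 * max (lo (w (n - 1))) (lo (c (j + 1))) + 1)
    refine hac (main (w (n - 1))) (TransGen.head' ⟨mid (c (n - 1)), hT₂ _ _ (hO _) hcX hcx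
      hwy' hwX' (by omega), hmid1⟩ ?_)
    refine (hstep _ O' hT₁ 1 (j - 1) le_rfl (by omega) (by omega)
      (fun k _ _ => hju k (by omega) (by omega) (by omega))
      (fun k _ _ => hny k (by omega) (by omega) (by omega))
      (fun k _ _ => hnX k (by omega) (by omega) (by omega))).trans ?_
    refine ReflTransGen.head (b := mid (c (n - 1))) ⟨main (c (j - 1)), ?_, ?_⟩ ?_
    · exact hT₁ _ _ (hO _) (hny _ (by omega) (by omega) (by omega)) hcj1
        (Or.inl (hnX _ (by omega) (by omega) (by omega))) (Or.inl hcj1X)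
    · exact hS's _ _ (hS₂ _ _ hcX hcx (hSY _ _ (hSs _ _ hSj) hy₀) hcj1)
    · refine ReflTransGen.head ⟨main (c (j + 1)), hO's _ _ (hT₂ _ _ hOd hcX hcx hdy hdX
        (by omega)), hSd'⟩ (hlast _ O' hT₁)
  · have hwy2 : ∀ k : ℤ, 0 ≤ k → k < n → w k ≠ y₀ := fun k h1 h2 => by
      by_cases h : k = j
      · rwa [h]
      · exact hny k h1 h2 h
    have hpath : ∀ (θ : ℕ) (O' : β → β → Prop), (∀ a c, O a c → a ≠ y₀ → c ≠ y₀ →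
        (¬ isX a ∨ a = x₀ ∨ θ < 2 * hi c) →
          (¬ isX c ∨ c = x₀ ∨ θ < 2 * hi a) → O' (main a) (main c)) →
        ReflTransGen (Step O' S') (main (w 1)) (main (c (n - 1))) := by
      intro θ O' hT₁
      refine (hstep θ O' hT₁ 1 j le_rfl (by omega) (by omega)
        (fun k _ _ => hju k (by omega) (by omega) (by omega))
        (fun k _ _ => hwy2 k (by omega) (by omega))
        (fun k _ _ => hnX k (by omega) (by omega) (by omega))).tail
        ⟨main x₀, ?_, hS₁ _ _ (hXS _ _ hx₀ hcX hcx.symm) hxy hcy₀⟩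
      rw [← hcjx]
      exact hT₁ _ _ (hO j) hwjy (hcy _ (by omega) (by omega))
        (Or.inl (hnX _ (by omega) (by omega) (by omega))) (Or.inr (Or.inl hcjx))
    by_cases hcmp : lo (w (n - 1)) < hi (c (j + 1))
    · obtain ⟨O', hO's, hac, hT₁, hT₂⟩ := hT (2 * lo (w (n - 1)) + 1)
      refine hac (main (w (n - 1))) (TransGen.head' ⟨mid (c (n - 1)), hT₂ _ _ (hO _) hcX hcx
        hwy' hwX' (by omega), hmid1⟩ ((hpath _ O' hT₁).trans ?_))
      exact ReflTransGen.head ⟨main (c (j + 1)), hO's _ _ (hT₁ _ _ hOd hdy hcy₀ (Or.inl hdX)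
        (Or.inr (Or.inr (by omega)))), hSd'⟩ (hlast _ O' hT₁)
    · have h1 := hlo _ _ hOd hdy
      have h2 := hlo _ _ (hO (n - 1)) hwy'
      obtain ⟨O', hO's, hac, hT₁, hT₂⟩ := hT (2 * lo (c (j + 1)) + 1)
      obtain ⟨b', h3, h4⟩ := exists_reverse hO's hS's hSd' (hlast _ O' hT₁)
      refine hac (main (c (j + 1))) (TransGen.head' ⟨mid (c (n - 1)), hT₂ _ _ hOd hcX hcx
        hdy hdX (by omega), hmid1⟩ ((hpath _ O' hT₁).trans ?_))
      exact ReflTransGen.head ⟨main (w (n - 1)), hO's _ _ (hT₁ _ _ (hO _) hwy' hcy₀ (Or.inl hwX')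
        (Or.inr (Or.inr (by omega)))), h3⟩ h4

end Cycles

section Expansion

variable {x y : X}

/-- The length function before the substitution `x ↦ y x`, given the one after it. -/
def extLen (x y : X) (L : X → ℕ) (z : X) : ℕ := if z = x then L x + L y else L z

/-- The two sides after the substitution `x ↦ y x` and the removal of the first letter. -/
def expTail (x y : X) (W : ℕ → List X) (i : ℕ) : List X := (expand x y (W i)).tail

/-- The end of the segment `b` after the substitution. -/
def mainB (x : X) (W : ℕ → List X) (b : ℕ × ℕ) : ℕ × ℕ := (b.1, b.2 + ((W b.1).take b.2).count x - 1)

/-- The boundary inside the segment `b`, which carries the letter `x`, after the substitution. -/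
def midB (x : X) (W : ℕ → List X) (b : ℕ × ℕ) : ℕ × ℕ := (b.1, (mainB x W b).2 - 1)

lemma expand_append (l l' : List X) : expand x y (l ++ l') = expand x y l ++ expand x y l' := by
  simp [expand]

lemma expand_cons (z : X) (l : List X) :
    expand x y (z :: l) = (if z = x then [y, x] else [z]) ++ expand x y l := by
  simp [expand]

lemma length_expand (l : List X) : (expand x y l).length = l.length + l.count x := by
  induction l with
  | nil => simp [expand]
  | cons a l ih =>
    rw [expand_cons, List.length_append, ih, List.count_cons, List.length_cons]
    by_cases h : a = x <;> simp [h] <;> omega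

lemma sum_expand (L : X → ℕ) (l : List X) :
    ((expand x y l).map L).sum = (l.map (extLen x y L)).sum := by
  induction l with
  | nil => simp [expand]
  | cons a l ih =>
    rw [expand_cons, List.map_append, List.sum_append, ih, List.map_cons, List.sum_cons]
    by_cases h : a = x <;> simp [h, extLen, add_comm]

lemma take_expand {l : List X} {j : ℕ} (hj : j ≤ l.length) :
    (expand x y l).take (j + (l.take j).count x) = expand x y (l.take j) := by
  conv_lhs => rw [← List.take_append_drop j l, expand_append]
  refine List.take_left' ?_
  simp [length_expand, hj]

lemma getElem?_expand {l : List X} {j : ℕ} {z : X} (h : l[j]? = some z) :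
    (expand x y l)[j + (l.take j).count x]? = some (if z = x then y else z) ∧
      (z = x → (expand x y l)[j + (l.take j).count x + 1]? = some x) := by
  obtain ⟨hj, rfl⟩ := List.getElem?_eq_some_iff.1 h
  have h1 : expand x y l = expand x y (l.take j) ++
      ((if l[j] = x then [y, x] else [l[j]]) ++ expand x y (l.drop (j + 1))) := by
    rw [← expand_cons, ← List.drop_eq_getElem_cons hj, ← expand_append, List.take_append_drop]
  have h2 : (expand x y (l.take j)).length = j + (l.take j).count x := by
    simp [length_expand, hj.le]
  rw [h1]
  constructor
  · rw [List.getElem?_append_right (by omega), h2, Nat.sub_self]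
    split_ifs <;> simp
  · intro hx
    rw [List.getElem?_append_right (by omega), h2, Nat.add_sub_cancel_left, if_pos hx]
    simp

lemma count_take_succ {l : List X} {j : ℕ} {z : X} (h : l[j]? = some z) :
    (l.take (j + 1)).count x = (l.take j).count x + if z = x then 1 else 0 := by
  rw [List.take_add_one, h, List.count_append]
  simp [List.count_singleton]

lemma extLen_pos {L : X → ℕ} (hL : ∀ z, 0 < L z) (z : X) : 0 < extLen x y L z := by
  have := hL z
  have := hL x
  unfold extLen
  split_ifs <;> omega

variable {W : ℕ → List X} {L : X → ℕ}

/-- `x` and `y` are the distinct first letters of the two sides. -/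
structure Heads (W : ℕ → List X) (x y : X) : Prop where
  fst : ltr W (1, 1) = some x
  snd : ltr W (2, 1) = some y
  ne : x ≠ y

namespace Heads

variable (h : Heads W x y)
include h

lemma isB_fst : IsB W (1, 1) := by
  obtain ⟨h', -⟩ := List.getElem?_eq_some_iff.1 h.fst
  exact ⟨Or.inl rfl, le_rfl, h'⟩

lemma isB_snd : IsB W (2, 1) := by
  obtain ⟨h', -⟩ := List.getElem?_eq_some_iff.1 h.snd
  exact ⟨Or.inr rfl, le_rfl, h'⟩

lemma expand_eq {i : ℕ} (hi : i = 1 ∨ i = 2) :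
    expand x y (W i) = y :: expTail x y W i := by
  have key : ∀ l : List X, (l[0]? = some x ∨ l[0]? = some y) →
      expand x y l = y :: (expand x y l).tail := by
    rintro (_ | ⟨a, l⟩) hl
    · simp at hl
    · simp only [List.getElem?_cons_zero, Option.some.injEq] at hl
      rw [expand_cons]
      rcases hl with rfl | rfl
      · simp
      · simp [h.ne.symm]
  rcases hi with rfl | rfl
  · exact key _ (Or.inl h.fst)
  · exact key _ (Or.inr h.snd)

lemma pos_expTail {i t : ℕ} (hi : i = 1 ∨ i = 2) :
    pos (expTail x y W) L (i, t) + L y = (((expand x y (W i)).take (t + 1)).map L).sum := by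
  rw [h.expand_eq hi, List.take_succ_cons, List.map_cons, List.sum_cons, add_comm]
  rfl

lemma pos_expand {i j : ℕ} (hi : i = 1 ∨ i = 2) (hj : j ≤ (W i).length)
    (hj1 : 1 ≤ j + ((W i).take j).count x) :
    pos (expTail x y W) L (i, j + ((W i).take j).count x - 1) + L y =
      pos W (extLen x y L) (i, j) := by
  rw [h.pos_expTail hi, Nat.sub_add_cancel hj1, take_expand hj, sum_expand]
  rfl

lemma pos_main {b : ℕ × ℕ} (hb : IsB W b) :
    pos (expTail x y W) L (mainB x W b) + L y = pos W (extLen x y L) b :=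
  h.pos_expand hb.1 hb.2.2 (by have := hb.2.1; omega)

lemma getElem?_expTail {i t : ℕ} (hi : i = 1 ∨ i = 2) :
    (expTail x y W i)[t]? = (expand x y (W i))[t + 1]? := by
  rw [h.expand_eq hi, List.getElem?_cons_succ]

lemma one_le_main {b : ℕ × ℕ} (hb : IsB W b) (hb2 : b ≠ (2, 1)) : 1 ≤ (mainB x W b).2 := by
  obtain ⟨i, j⟩ := b
  obtain ⟨hi, hj, hj'⟩ := hb
  simp only [mainB] at *
  rcases hi with rfl | rfl
  · have h1 : 0 < ((W 1).take j).count x := by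
      rw [List.count_pos_iff, List.mem_take_iff_getElem]
      obtain ⟨h2, h3⟩ := List.getElem?_eq_some_iff.1 h.fst
      exact ⟨0, by simp only at h2; omega, h3⟩
    omega
  · have : j ≠ 1 := fun h => hb2 (by rw [h])
    omega

lemma length_expTail {i : ℕ} : (expTail x y W i).length = (W i).length + (W i).count x - 1 := by
  simp [expTail, length_expand]

lemma isB_main {b : ℕ × ℕ} (hb : IsB W b) (hb2 : b ≠ (2, 1)) :
    IsB (expTail x y W) (mainB x W b) := by
  refine ⟨hb.1, h.one_le_main hb hb2, ?_⟩
  have h1 := (List.take_sublist b.2 (W b.1)).count_le x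
  have h2 := hb.2.2
  rw [h.length_expTail]
  simp only [mainB]
  omega

lemma ltr_main {b : ℕ × ℕ} (hb : IsB W b) (hb2 : b ≠ (2, 1)) :
    ltr (expTail x y W) (mainB x W b) = ltr W b := by
  have h1 := h.one_le_main hb hb2
  obtain ⟨z, hz⟩ := exists_ltr hb
  rw [hz]
  obtain ⟨i, j⟩ := b
  obtain ⟨j, rfl⟩ : ∃ k, j = k + 1 := ⟨j - 1, by have := hb.2.1; simp only at this; omega⟩
  simp only [ltr, Nat.add_sub_cancel] at hz
  simp only [mainB] at h1
  simp only [ltr, mainB]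
  rw [h.getElem?_expTail hb.1, Nat.sub_add_cancel h1]
  obtain ⟨h2, h3⟩ := getElem?_expand (x := x) (y := y) hz
  have h4 := count_take_succ (x := x) hz
  split_ifs at h4 with hzx
  · rw [hzx, ← h3 hzx]
    congr 1
    omega
  · rw [if_neg hzx] at h2
    rw [← h2]
    congr 1
    omega

lemma next_main {b : ℕ × ℕ} (hb : IsB W b) :
    (expTail x y W b.1)[(mainB x W b).2]? ≠ some x := by
  have h1 := hb.2.1
  rw [h.getElem?_expTail hb.1]
  simp only [mainB]
  rw [Nat.sub_add_cancel (by omega)]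
  rcases hz : (W b.1)[b.2]? with _ | z
  · have h2 := List.getElem?_eq_none_iff.1 hz
    rw [List.take_of_length_le h2, List.getElem?_eq_none (by rw [length_expand]; omega)]
    simp
  · rw [(getElem?_expand hz).1]
    split_ifs with hzx
    · exact fun h' => h.ne (Option.some.inj h').symm
    · exact fun h' => hzx (Option.some.inj h')

lemma main_pred {b : ℕ × ℕ} (hb : IsB W b) (hb2 : b ≠ (2, 1)) (hx : ltr W b ≠ some x) :
    IsB W (b.1, b.2 - 1) ∧
      mainB x W (b.1, b.2 - 1) = ((mainB x W b).1, (mainB x W b).2 - 1) := by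
  obtain ⟨z, hz⟩ := exists_ltr hb
  obtain ⟨i, j⟩ := b
  have hb1 : j ≠ 1 := by
    rintro rfl
    rcases hb.1 with h' | h' <;> simp only at h' <;> subst h'
    · exact hx h.fst
    · exact hb2 rfl
  obtain ⟨j, rfl⟩ : ∃ k, j = k + 1 := ⟨j - 1, by have := hb.2.1; simp only at this; omega⟩
  have h2 := hb.2.2
  simp only at h2
  refine ⟨⟨hb.1, by simp only; omega, by simp only; omega⟩, ?_⟩
  rw [hz] at hx
  simp only [ltr, Nat.add_sub_cancel] at hz
  have h4 := count_take_succ (x := x) hz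
  rw [if_neg fun h' => hx (by rw [h'])] at h4
  simp only [mainB, Nat.add_sub_cancel, Prod.mk.injEq, true_and]
  omega

lemma mid_spec {b : ℕ × ℕ} (hb : IsB W b) (hb1 : b ≠ (1, 1)) (hx : ltr W b = some x) :
    IsB W (b.1, b.2 - 1) ∧ 1 ≤ (midB x W b).2 ∧ (midB x W b).2 < (expTail x y W b.1).length ∧
      (midB x W b).2 + 1 = (mainB x W b).2 ∧
      (expTail x y W b.1)[(midB x W b).2]? = some x ∧
      ltr (expTail x y W) (midB x W b) = some y ∧
      ∀ L : X → ℕ, pos (expTail x y W) L (b.1, (midB x W b).2 - 1) + L y =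
        pos W (extLen x y L) (b.1, b.2 - 1) := by
  have hb2 : b ≠ (2, 1) := by
    rintro rfl
    exact h.ne (Option.some.inj (hx.symm.trans h.snd))
  have hm := (h.isB_main hb hb2).2.2
  obtain ⟨i, j⟩ := b
  obtain ⟨j, rfl⟩ : ∃ k, j = k + 1 := ⟨j - 1, by have := hb.2.1; simp only at this; omega⟩
  have hj : j ≠ 0 := by
    rintro rfl
    rcases hb.1 with h' | h' <;> simp only at h' <;> subst h'
    · exact hb1 rfl
    · exact hb2 rfl
  have h2 := hb.2.2
  simp only [ltr, Nat.add_sub_cancel] at hx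
  have h4 := count_take_succ (x := x) hx
  rw [if_pos rfl] at h4
  have h5 : (midB x W (i, j + 1)).2 = j + ((W i).take j).count x := by
    simp only [midB, mainB]
    omega
  have h6 : (midB x W (i, j + 1)).2 + 1 = (mainB x W (i, j + 1)).2 := by
    rw [h5]
    simp only [mainB]
    omega
  obtain ⟨h7, h8⟩ := getElem?_expand (x := x) (y := y) hx
  simp only [mainB] at hm
  refine ⟨⟨hb.1, by simp only; omega, by simp only at h2 ⊢; omega⟩, by omega, ?_, h6, ?_, ?_, ?_⟩
  · rw [h5]
    simp only
    omega
  · rw [h.getElem?_expTail hb.1, h5]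
    exact h8 rfl
  · have h9 : (expTail x y W i)[j + ((W i).take j).count x - 1]? = some y := by
      rw [h.getElem?_expTail hb.1, Nat.sub_add_cancel (by omega), h7, if_pos rfl]
    rw [← h5] at h9
    exact h9
  · intro L
    rw [h5]
    exact h.pos_expand hb.1 (by simp only at h2 ⊢; omega) (by simp only; omega)

lemma isB_mid {b : ℕ × ℕ} (hb : IsB W b) (hb1 : b ≠ (1, 1)) (hx : ltr W b = some x) :
    IsB (expTail x y W) (midB x W b) :=
  have := h.mid_spec hb hb1 hx
  ⟨hb.1, this.2.1, this.2.2.1.le⟩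

lemma main_inj {a b : ℕ × ℕ} (ha : IsB W a) (hb : IsB W b)
    (hab : mainB x W a = mainB x W b) : a = b := by
  have h1 := h.pos_main (L := fun _ => 1) ha
  have h2 := h.pos_main (L := fun _ => 1) hb
  rw [hab, h2] at h1
  obtain ⟨i, j⟩ := a
  obtain ⟨i', k⟩ := b
  obtain rfl : i = i' := congrArg Prod.fst hab
  have hp := extLen_pos (x := x) (y := y) (L := fun _ => 1) fun _ => one_pos
  rcases lt_trichotomy j k with hlt | rfl | hlt
  · have := pos_lt (i := i) hp hlt hb.2.2
    omega
  · rfl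
  · have := pos_lt (i := i) hp hlt ha.2.2
    omega

lemma same_main {a b : ℕ × ℕ} (hab : Same W a b) (ha : a ≠ (2, 1)) (hb : b ≠ (2, 1)) :
    Same (expTail x y W) (mainB x W a) (mainB x W b) :=
  ⟨h.isB_main hab.1 ha, h.isB_main hab.2.1 hb, fun h' => hab.2.2.1 (h.main_inj hab.1 hab.2.1 h'),
    by rw [h.ltr_main hab.1 ha, h.ltr_main hab.2.1 hb, hab.2.2.2]⟩

lemma same_mid {c b : ℕ × ℕ} (hc : IsB W c) (hcx : ltr W c = some x) (hc1 : c ≠ (1, 1))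
    (hb : IsB W b) (hby : ltr W b = some y) (hb2 : b ≠ (2, 1)) :
    Same (expTail x y W) (midB x W c) (mainB x W b) := by
  have h1 := h.mid_spec hc hc1 hcx
  refine ⟨h.isB_mid hc hc1 hcx, h.isB_main hb hb2, fun h' => ?_, ?_⟩
  · have h2 := h1.2.2.2.2.1
    have h3 := h.next_main hb
    have h4 : (midB x W c).1 = (mainB x W b).1 := congrArg Prod.fst h'
    change c.1 = b.1 at h4
    rw [h', h4] at h2
    exact h3 h2
  · rw [h1.2.2.2.2.2.1, h.ltr_main hb hb2, hby]

end Heads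

end Expansion

section Core

open Relation

variable {x y : X} {W : ℕ → List X} {L M : X → ℕ}

/-- Two length functions order the boundaries in the same way. -/
def Agree (W : ℕ → List X) (L M : X → ℕ) : Prop :=
  ∀ a b, IsB W a → IsB W b → (pos W L a < pos W L b ↔ pos W M a < pos W M b)

lemma Agree.bal (h : Agree W L M) (h1 : IsB W (1, (W 1).length)) (h2 : IsB W (2, (W 2).length))
    (hb : Bal W L) : Bal W M := by
  have h3 := h _ _ h1 h2
  have h4 := h _ _ h2 h1
  unfold Bal at *
  omega

lemma agree_of_cross (hL : ∀ z, 0 < L z) (hM : ∀ z, 0 < M z) (hLb : Bal W L) (hMb : Bal W M)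
    (hLs : Stag W L) (hMs : Stag W M)
    (h : ∀ j k, 1 ≤ j → j < (W 1).length → 1 ≤ k → k < (W 2).length →
      (pos W L (1, j) < pos W L (2, k) ↔ pos W M (1, j) < pos W M (2, k))) : Agree W L M := by
  have top₁ : ∀ {K : X → ℕ}, (∀ z, 0 < K z) → Bal W K → ∀ k, k ≤ (W 2).length →
      (¬ pos W K (1, (W 1).length) < pos W K (2, k)) ∧
      (pos W K (2, k) < pos W K (1, (W 1).length) ↔ k < (W 2).length) := by
    intro K hK hb k hk
    have h1 := pos_mono (W := W) (L := K) (i := 2) hk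
    rw [hb]
    exact ⟨by omega, fun h => lt_of_pos_lt h, fun h => pos_lt hK h le_rfl⟩
  have top₂ : ∀ {K : X → ℕ}, (∀ z, 0 < K z) → Bal W K → ∀ k, k ≤ (W 1).length →
      (¬ pos W K (2, (W 2).length) < pos W K (1, k)) ∧
      (pos W K (1, k) < pos W K (2, (W 2).length) ↔ k < (W 1).length) := by
    intro K hK hb k hk
    have h1 := pos_mono (W := W) (L := K) (i := 1) hk
    rw [← hb]
    exact ⟨by omega, fun h => lt_of_pos_lt h, fun h => pos_lt hK h le_rfl⟩
  have cross : ∀ j k, 1 ≤ j → j ≤ (W 1).length → 1 ≤ k → k ≤ (W 2).length →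
      (pos W L (1, j) < pos W L (2, k) ↔ pos W M (1, j) < pos W M (2, k)) ∧
      (pos W L (2, k) < pos W L (1, j) ↔ pos W M (2, k) < pos W M (1, j)) := by
    intro j k hj hj' hk hk'
    rcases eq_or_lt_of_le hj' with rfl | hj''
    · have h1 := top₁ hL hLb k hk'
      have h2 := top₁ hM hMb k hk'
      exact ⟨by tauto, by tauto⟩
    rcases eq_or_lt_of_le hk' with rfl | hk''
    · have h1 := top₂ hL hLb j hj'
      have h2 := top₂ hM hMb j hj'
      exact ⟨by tauto, by tauto⟩
    have h1 := h j k hj hj'' hk hk''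
    have h2 := hLs j k hj' hk'
    have h3 := hMs j k hj' hk'
    omega
  have same : ∀ {K : X → ℕ}, (∀ z, 0 < K z) → ∀ i j k, j ≤ (W i).length → k ≤ (W i).length →
      (pos W K (i, j) < pos W K (i, k) ↔ j < k) := fun hK i j k _ hk =>
    ⟨fun h => lt_of_pos_lt h, fun h => pos_lt hK h hk⟩
  rintro ⟨i, j⟩ ⟨i', k⟩ ⟨hi, hj, hj'⟩ ⟨hi', hk, hk'⟩
  simp only at hi hj hj' hi' hk hk'
  rcases hi with rfl | rfl <;> rcases hi' with rfl | rfl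
  · rw [same hL _ _ _ hj' hk', same hM _ _ _ hj' hk']
  · exact (cross j k hj hj' hk hk').1
  · exact (cross k j hk hk' hj hj').2
  · rw [same hL _ _ _ hj' hk', same hM _ _ _ hj' hk']

namespace Heads

variable (h : Heads W x y)
include h

lemma isB_top₁ : IsB W (1, (W 1).length) := ⟨Or.inl rfl, h.isB_fst.2.2, le_rfl⟩

lemma isB_top₂ : IsB W (2, (W 2).length) := ⟨Or.inr rfl, h.isB_snd.2.2, le_rfl⟩

lemma main_top (i : ℕ) : mainB x W (i, (W i).length) = (i, (expTail x y W i).length) := by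
  rw [h.length_expTail]
  simp [mainB]

lemma pos_fst : pos W L (1, 1) = L x := by
  rw [pos_pred (b := (1, 1)) le_rfl h.fst]
  simp

lemma pos_snd : pos W L (2, 1) = L y := by
  rw [pos_pred (b := (2, 1)) le_rfl h.snd]
  simp

lemma extLen_snd_lt (hL : ∀ z, 0 < L z) : extLen x y L y < extLen x y L x := by
  have := hL x
  simp only [extLen, if_neg h.ne.symm, if_true]
  omega

lemma main_fst : (mainB x W (1, 1)).2 = 1 := by
  have := count_take_succ (x := x) (l := W 1) (j := 0) h.fst
  simp only [mainB]
  simp at this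
  omega

lemma bal_iff : Bal W (extLen x y L) ↔ Bal (expTail x y W) L := by
  have h1 := h.pos_main (L := L) h.isB_top₁
  have h2 := h.pos_main (L := L) h.isB_top₂
  rw [h.main_top] at h1 h2
  unfold Bal
  omega

lemma main_lt_top {b : ℕ × ℕ} (hb : IsB W b) (hlt : b.2 < (W b.1).length) :
    (mainB x W b).2 < (expTail x y W b.1).length := by
  have h1 := (List.take_sublist b.2 (W b.1)).count_le x
  have h2 := hb.2.1
  rw [h.length_expTail]
  simp only [mainB]
  omega

lemma stag_extLen (hL : ∀ z, 0 < L z) (hs : Stag (expTail x y W) L) :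
    Stag W (extLen x y L) := by
  intro j k hj hk he
  have hp := extLen_pos (x := x) (y := y) hL
  have h0 : ∀ i t, 1 ≤ t → t ≤ (W i).length → 0 < pos W (extLen x y L) (i, t) := fun i t h1 h2 => by
    have := pos_lt (i := i) (j := 0) hp h1 h2
    omega
  by_cases hj0 : j = 0
  · subst hj0
    rw [pos_zero] at he
    by_contra hk0
    have := h0 2 k (by omega) hk
    omega
  by_cases hk0 : k = 0
  · subst hk0
    rw [pos_zero] at he
    have := h0 1 j (by omega) hj
    omega
  have hbj : IsB W (1, j) := ⟨Or.inl rfl, by simp only; omega, hj⟩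
  have hbk : IsB W (2, k) := ⟨Or.inr rfl, by simp only; omega, hk⟩
  have h1 := h.pos_main (L := L) hbj
  have h2 := h.pos_main (L := L) hbk
  have h3 : 1 ≤ (mainB x W (1, j)).2 := h.one_le_main hbj (by simp)
  have hk2 : (mainB x W (2, k)).2 ≤ (expTail x y W 2).length := by
    by_cases h4 : ((2, k) : ℕ × ℕ) = (2, 1)
    · obtain rfl : k = 1 := congrArg Prod.snd h4
      have := (List.take_sublist 1 (W 2)).count_le x
      rw [h.length_expTail]
      simp only [mainB]
      omega
    · exact (h.isB_main hbk h4).2.2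
  rcases hs _ _ (h.isB_main hbj (by simp)).2.2 hk2 (show pos _ _ (mainB x W (1, j)) =
    pos _ _ (mainB x W (2, k)) by omega) with h4 | h4
  · omega
  · refine Or.inr ⟨?_, ?_⟩
    · by_contra h5
      have := h.main_lt_top hbj (by simp only; omega)
      simp only at this
      omega
    · by_contra h5
      have := h.main_lt_top hbk (by simp only; omega)
      simp only at this
      omega

end Heads

/-- If the configuration obtained by the substitution `x ↦ y x` can be staggered, and all such
staggered configurations have acyclic cut graph, then the original cut graph is acyclic. -/
theorem sAcyc_of_expTail (h : Heads W x y) {L₀ : X → ℕ} (hL₀ : ∀ z, 0 < L₀ z)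
    (hyx : L₀ y < L₀ x) (hs₀ : Stag W L₀) (hb₀ : Bal W L₀)
    (hE : ∃ L, (∀ z, 0 < L z) ∧ Agree W L₀ (extLen x y L) ∧ Stag (expTail x y W) L)
    (hA : ∀ L, (∀ z, 0 < L z) → Agree W L₀ (extLen x y L) → Stag (expTail x y W) L →
      SAcyc (expTail x y W) L) : SAcyc W L₀ := by
  obtain ⟨L₁, hL₁, hag₁, hs₁⟩ := hE
  have hmain : ∀ {L : X → ℕ}, Agree W L₀ (extLen x y L) → ∀ {a b}, IsB W a → IsB W b →
      (pos W L₀ a < pos W L₀ b ↔ pos (expTail x y W) L (mainB x W a) < pos (expTail x y W) L (mainB x W b)) := by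
    intro L hL a b ha hb
    rw [hL a b ha hb, ← h.pos_main ha, ← h.pos_main hb]
    omega
  have hbal : ∀ {L : X → ℕ}, Agree W L₀ (extLen x y L) → Bal (expTail x y W) L := fun hL =>
    h.bal_iff.1 (hL.bal h.isB_top₁ h.isB_top₂ hb₀)
  refine acyclic_of_split (O := Overlap W L₀) (S := Same W) (fun a b => Overlap.symm)
    (fun a b => Same.symm) (fun a ha => ha.2.2.1 rfl) (fun a b hab => hab.2.2.1)
    (isX := fun a => IsB W a ∧ ltr W a = some x) (isY := fun a => IsB W a ∧ ltr W a = some y)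
    (fun a b hab ha => ⟨hab.2.1, hab.2.2.2 ▸ ha.2⟩) (fun a b hab ha => ⟨hab.2.1, hab.2.2.2 ▸ ha.2⟩)
    (fun a b ha hb hab => ⟨ha.1, hb.1, hab, ha.2.trans hb.2.symm⟩)
    (x₀ := (1, 1)) (y₀ := (2, 1)) ⟨h.isB_fst, h.fst⟩ ⟨h.isB_snd, h.snd⟩
    (fun h' => h.ne (Option.some.inj (h'.2.symm.trans h.snd))) ?_
    (main := mainB x W) (mid := midB x W) (S' := Same (expTail x y W)) (fun a b => Same.symm)
    (fun a b hab ha hb => h.same_main hab ha hb)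
    (fun c b hc hc1 hb hb2 => h.same_mid hc.1 hc.2 hc1 hb.1 hb.2 hb2)
    (lo := fun a => pos (expTail x y W) L₁ ((mainB x W a).1, (mainB x W a).2 - 1)) (hi := fun a => pos (expTail x y W) L₁ (mainB x W a)) ?_ ?_
  · rintro ⟨i, j⟩ ⟨ha, -, hne, hlt, -⟩
    simp only at hne hlt
    rw [h.pos_snd] at hlt
    obtain ⟨hi, hj, -⟩ := ha
    simp only at hi hj
    obtain rfl : i = 1 := by omega
    have : j - 1 < 1 := lt_of_pos_lt (W := W) (L := L₀) (i := 1) (by rw [h.pos_fst]; omega)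
    rw [show j = 1 by omega]
  · intro a b hab ha
    have h1 := h.isB_main hab.1 ha
    exact pos_lt hL₁ (Nat.sub_lt h1.2.1 Nat.one_pos) h1.2.2
  intro θ
  set key : ℕ × ℕ → ℕ := fun b => if (expTail x y W b.1)[b.2]? = some x then
    max (2 * pos (expTail x y W) L₁ (b.1, b.2 - 1) + 1) (min (2 * pos (expTail x y W) L₁ (b.1, b.2 + 1) - 1) θ) else 2 * pos (expTail x y W) L₁ b with hkey
  have keyMono : ∀ i k, key (i, k) ≤ key (i, k + 1) := by
    intro i k
    have h1 : pos (expTail x y W) L₁ (i, k - 1) ≤ pos (expTail x y W) L₁ (i, k) := pos_mono (by omega)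
    have h2 : pos (expTail x y W) L₁ (i, k) ≤ pos (expTail x y W) L₁ (i, k + 1) := pos_mono (by omega)
    have h3 : pos (expTail x y W) L₁ (i, k + 1) ≤ pos (expTail x y W) L₁ (i, k + 1 + 1) := pos_mono (by omega)
    have h4 : (expTail x y W i)[k]? = some x → pos (expTail x y W) L₁ (i, k) < pos (expTail x y W) L₁ (i, k + 1) := fun h' => by
      obtain ⟨h5, -⟩ := List.getElem?_eq_some_iff.1 h'
      exact pos_lt hL₁ (by omega) h5
    simp only [hkey, Nat.add_sub_cancel]
    split_ifs with h5 h6 h6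
    · omega
    · have := h4 h5
      omega
    · omega
    · omega
  have keyMain : ∀ {b}, IsB W b → key (mainB x W b) = 2 * pos (expTail x y W) L₁ (mainB x W b) := fun hb => by
    simp only [hkey]
    exact if_neg (h.next_main hb)
  obtain ⟨L, ⟨hL, hag, hs⟩, hR⟩ := exists_arrangement (W := expTail x y W)
    (fun L => (∀ z, 0 < L z) ∧ Agree W L₀ (extLen x y L) ∧ Stag (expTail x y W) L)
    (fun j k => key (1, j) < key (2, k))
    (fun L ⟨h1, h2, h3⟩ => ⟨h1, hbal h2, h3, hA L h1 h2 h3⟩)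
    (fun j k _ _ _ _ h' => lt_of_le_of_lt (keyMono _ _) h')
    (fun j k _ _ _ _ h' => lt_of_lt_of_le h' (keyMono _ _))
    (by
      rintro L L₂ ⟨h1, h2, h3⟩ h4 h5 h6 h7
      refine ⟨h4, ?_, h6⟩
      refine agree_of_cross hL₀ (extLen_pos h4) hb₀ (h.bal_iff.2 h5) hs₀ (h.stag_extLen h4 h6) ?_
      intro j k hj hj' hk hk'
      have hbj : IsB W (1, j) := ⟨Or.inl rfl, hj, hj'.le⟩
      have hbk : IsB W (2, k) := ⟨Or.inr rfl, hk, hk'.le⟩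
      by_cases hk1 : k = 1
      · subst hk1
        rw [h.pos_snd, h.pos_snd]
        have h8 := pos_mono (W := W) (L := L₀) (i := 1) hj
        have h9 := pos_mono (W := W) (L := extLen x y L₂) (i := 1) hj
        rw [h.pos_fst] at h8 h9
        have h10 := h.extLen_snd_lt h4
        omega
      have hk2 : ((2, k) : ℕ × ℕ) ≠ (2, 1) := by simpa using hk1
      have h8 : (pos (expTail x y W) L (mainB x W (1, j)) < pos (expTail x y W) L (mainB x W (2, k)) ↔
          key (mainB x W (1, j)) < key (mainB x W (2, k))) := by
        rw [keyMain hbj, keyMain hbk, ← hmain h2 hbj hbk, hmain hag₁ hbj hbk]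
        omega
      have h9 := h7 _ _ (h.one_le_main hbj (by simp)) (h.main_lt_top hbj hj')
        (h.one_le_main hbk hk2) (h.main_lt_top hbk hk') h8
      rw [hmain h2 hbj hbk, ← h.pos_main hbj, ← h.pos_main hbk]
      have h10 : (pos (expTail x y W) L₂ (mainB x W (1, j)) < pos (expTail x y W) L₂ (mainB x W (2, k)) ↔
          key (mainB x W (1, j)) < key (mainB x W (2, k))) := h9
      rw [h8, ← h10]
      omega)
    L₁ ⟨hL₁, hag₁, hs₁⟩
  have hVb := hbal hag
  have cmp : ∀ a b, IsB (expTail x y W) a → a.2 < (expTail x y W a.1).length → IsB (expTail x y W) b → b.2 < (expTail x y W b.1).length → a.1 ≠ b.1 →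
      key a < key b → pos (expTail x y W) L a < pos (expTail x y W) L b := by
    rintro ⟨i, j⟩ ⟨i', k⟩ ⟨hi, hj, -⟩ hj' ⟨hi', hk, -⟩ hk' hne hlt
    simp only at hi hj hj' hi' hk hk' hne
    rcases hi with rfl | rfl <;> rcases hi' with rfl | rfl
    · exact absurd rfl hne
    · exact (hR j k hj hj' hk hk').2 hlt
    · have h1 := hR k j hk hk' hj hj'
      have h2 := hs k j hk'.le hj'.le
      omega
    · exact absurd rfl hne
  have before : ∀ c e, IsB W c → c ≠ (1, 1) → ltr W c = some x → IsB W e → e ≠ (2, 1) → c.1 ≠ e.1 →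
      pos (expTail x y W) L₁ (c.1, (midB x W c).2 - 1) < pos (expTail x y W) L₁ (mainB x W e) → θ < 2 * pos (expTail x y W) L₁ (mainB x W e) →
      pos (expTail x y W) L (midB x W c) < pos (expTail x y W) L (mainB x W e) := by
    intro c e hc hc1 hcx he he2 hne h1 h2
    obtain ⟨-, hm1, hm2, hm3, hm4, -⟩ := h.mid_spec hc hc1 hcx
    have hBe := h.isB_main he he2
    by_cases htop : (mainB x W e).2 < (expTail x y W e.1).length
    · refine cmp _ _ (h.isB_mid hc hc1 hcx) hm2 hBe htop hne ?_
      rw [keyMain he]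
      simp only [hkey]
      rw [if_pos (show (expTail x y W (midB x W c).1)[(midB x W c).2]? = some x from hm4)]
      have : pos (expTail x y W) L₁ ((midB x W c).1, (midB x W c).2 - 1) < pos (expTail x y W) L₁ (mainB x W e) := h1
      omega
    · have h3 : (mainB x W e).2 = (expTail x y W e.1).length := le_antisymm hBe.2.2 (not_lt.1 htop)
      have h4 : pos (expTail x y W) L (midB x W c) < pos (expTail x y W) L (c.1, (expTail x y W c.1).length) := pos_lt hL hm2 le_rfl
      have h5 : pos (expTail x y W) L (mainB x W e) = pos (expTail x y W) L (e.1, (expTail x y W e.1).length) := by rw [← h3]; rfl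
      rw [h5]
      unfold Bal at hVb
      rcases hc.1 with h6 | h6 <;> rcases he.1 with h7 | h7 <;> rw [h6] at h4 hne <;>
        rw [h7] at hne ⊢ <;> first | exact absurd rfl hne | omega
  have after : ∀ c e, IsB W c → c ≠ (1, 1) → ltr W c = some x → IsB W e → c.1 ≠ e.1 →
      1 ≤ (mainB x W e).2 → (mainB x W e).2 < (expTail x y W e.1).length →
      pos (expTail x y W) L₁ (mainB x W e) < pos (expTail x y W) L₁ (mainB x W c) → 2 * pos (expTail x y W) L₁ (mainB x W e) < θ →
      pos (expTail x y W) L (mainB x W e) < pos (expTail x y W) L (midB x W c) := by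
    intro c e hc hc1 hcx he hne he1 htop h1 h2
    obtain ⟨-, hm1, hm2, hm3, hm4, -⟩ := h.mid_spec hc hc1 hcx
    refine cmp _ _ ⟨he.1, he1, htop.le⟩ htop (h.isB_mid hc hc1 hcx) hm2 hne.symm ?_
    rw [keyMain he]
    simp only [hkey]
    rw [if_pos (show (expTail x y W (midB x W c).1)[(midB x W c).2]? = some x from hm4),
      hm3]
    have : pos (expTail x y W) L₁ (mainB x W e) < pos (expTail x y W) L₁ ((midB x W c).1, (mainB x W c).2) := h1
    omega
  have half : ∀ a c, Overlap W L₀ a c → a ≠ (2, 1) → c ≠ (2, 1) →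
      (¬ (IsB W a ∧ ltr W a = some x) ∨ a = (1, 1) ∨ θ < 2 * pos (expTail x y W) L₁ (mainB x W c)) →
      pos (expTail x y W) L ((mainB x W a).1, (mainB x W a).2 - 1) < pos (expTail x y W) L (mainB x W c) := by
    intro a c hac ha hc hgood
    by_cases ha1 : a = (1, 1)
    · subst ha1
      have hBc := h.isB_main hac.2.1 hc
      rw [h.main_fst, Nat.sub_self, pos_zero, ← pos_zero (W := expTail x y W) (L := L) (mainB x W c).1]
      exact pos_lt hL hBc.2.1 hBc.2.2
    by_cases hax : ltr W a = some x
    · have hθ : θ < 2 * pos (expTail x y W) L₁ (mainB x W c) := by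
        rcases hgood with h1 | h1 | h1
        · exact absurd ⟨hac.1, hax⟩ h1
        · exact absurd h1 ha1
        · exact h1
      obtain ⟨hm0, hm1, hm2, hm3, hm4, -, hm5⟩ := h.mid_spec hac.1 ha1 hax
      refine before a c hac.1 ha1 hax hac.2.1 hc hac.2.2.1 ?_ hθ
      have h1 := (hag₁ _ _ hm0 hac.2.1).1 hac.2.2.2.1
      rw [← hm5, ← h.pos_main hac.2.1] at h1
      exact Nat.lt_of_add_lt_add_right h1
    · obtain ⟨h1, h2⟩ := h.main_pred hac.1 ha hax
      rw [← h2]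
      exact (hmain hag h1 hac.2.1).1 hac.2.2.2.1
  refine ⟨Overlap (expTail x y W) L, fun a b => Overlap.symm, hA L hL hag hs, ?_, ?_⟩
  · intro a c hac ha hc ha' hc'
    exact ⟨h.isB_main hac.1 ha, h.isB_main hac.2.1 hc, hac.2.2.1, half a c hac ha hc ha',
      half c a hac.symm hc ha hc'⟩
  · intro a c hac hcX hc1 ha2 haX hlo
    have hax : ltr W a ≠ some x := fun h' => haX ⟨hac.1, h'⟩
    obtain ⟨hm0, hm1, hm2, hm3, hm4, -, hm5⟩ := h.mid_spec hcX.1 hc1 hcX.2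
    obtain ⟨h1, h2⟩ := h.main_pred hac.1 ha2 hax
    refine ⟨h.isB_main hac.1 ha2, h.isB_mid hcX.1 hc1 hcX.2, hac.2.2.1, ?_, ?_⟩
    · rw [← h2] at hlo ⊢
      have hBa := h.isB_main hac.1 ha2
      by_cases hz : 1 ≤ (mainB x W (a.1, a.2 - 1)).2
      · refine after c _ hcX.1 hc1 hcX.2 h1 hac.2.2.1.symm hz ?_
          ((hmain hag₁ h1 hac.2.1).1 hac.2.2.2.1) hlo
        rw [h2]
        have h3 := hBa.2.1
        have h4 := hBa.2.2
        have h5 : (mainB x W a).2 - 1 < (expTail x y W (mainB x W a).1).length := by omega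
        exact h5
      · have h3 : mainB x W (a.1, a.2 - 1) = (a.1, 0) := Prod.ext rfl (by simp only; omega)
        rw [h3, pos_zero, ← pos_zero (W := expTail x y W) (L := L) c.1]
        exact pos_lt hL hm1 hm2.le
    · have h3 := (hag _ _ hm0 hac.1).1 hac.2.2.2.2
      rw [← hm5, ← h.pos_main hac.1] at h3
      exact Nat.lt_of_add_lt_add_right h3

end Core

section Translation

open Relation

variable {U₁ U₂ U₁' U₂' : List X} {lt lt' : BRel} {L : X → ℕ} {x y : X}

/-- The length function `L` induces the order `lt` on the boundaries. -/
def Realizes (U₁ U₂ : List X) (lt : BRel) (L : X → ℕ) : Prop :=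
  (∀ z, 0 < L z) ∧ ∀ a b, EBoundary U₁ U₂ a → EBoundary U₁ U₂ b →
    (lt a b ↔ pos (word U₁ U₂) L a < pos (word U₁ U₂) L b)

lemma IsB.eBoundary {a : ℕ × ℕ} (h : IsB (word U₁ U₂) a) : EBoundary U₁ U₂ a := ⟨h.1, h.2.2⟩

lemma IsB.eBoundary_pred {a : ℕ × ℕ} (h : IsB (word U₁ U₂) a) :
    EBoundary U₁ U₂ (a.1, a.2 - 1) := ⟨h.1, (Nat.sub_le _ _).trans h.2.2⟩

lemma eBoundary_one {j : ℕ} (h : j ≤ U₁.length) : EBoundary U₁ U₂ (1, j) := ⟨Or.inl rfl, h⟩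

lemma eBoundary_two {j : ℕ} (h : j ≤ U₂.length) : EBoundary U₁ U₂ (2, j) := ⟨Or.inr rfl, h⟩

lemma BoundaryOrder.zero_lt_self (h : BoundaryOrder U₁ U₂ lt) {i j : ℕ}
    (hj : EBoundary U₁ U₂ (i, j + 1)) : lt (i, 0) (i, j + 1) := by
  induction j with
  | zero => exact h.succ i 0 hj
  | succ j ih =>
    have hj' : EBoundary U₁ U₂ (i, j + 1) := ⟨hj.1, (Nat.le_succ _).trans hj.2⟩
    exact h.trans _ _ _ ⟨hj.1, Nat.zero_le _⟩ hj' hj (ih hj') (h.succ i (j + 1) hj)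

lemma BoundaryOrder.incomp_zero (h : BoundaryOrder U₁ U₂ lt) {i i' : ℕ} (hi : i = 1 ∨ i = 2)
    (hi' : i' = 1 ∨ i' = 2) : Incomp lt (i, 0) (i', 0) := by
  have hirr : ∀ k, k = 1 ∨ k = 2 → ¬ lt (k, 0) (k, 0) := fun k hk =>
    h.irrefl _ ⟨hk, Nat.zero_le _⟩
  rcases hi with rfl | rfl <;> rcases hi' with rfl | rfl
  · exact ⟨hirr _ (Or.inl rfl), hirr _ (Or.inl rfl)⟩
  · exact h.bot
  · exact h.bot.symm
  · exact ⟨hirr _ (Or.inr rfl), hirr _ (Or.inr rfl)⟩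

lemma BoundaryOrder.zero_lt (h : BoundaryOrder U₁ U₂ lt) {i i' j : ℕ} (hi : i = 1 ∨ i = 2)
    (hj : EBoundary U₁ U₂ (i', j + 1)) :
    lt (i, 0) (i', j + 1) ∧ ¬ lt (i', j + 1) (i, 0) := by
  have h0 : EBoundary U₁ U₂ (i, 0) := ⟨hi, Nat.zero_le _⟩
  have h0' : EBoundary U₁ U₂ (i', 0) := ⟨hj.1, Nat.zero_le _⟩
  have hinc := h.incomp_zero hi hj.1
  have hlt := h.zero_lt_self hj
  have hn : ¬ lt (i', j + 1) (i, 0) := fun h' => hinc.2 (h.trans _ _ _ h0' hj h0 hlt h')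
  refine ⟨?_, hn⟩
  by_contra h'
  exact (h.incomp_trans _ _ _ h0' h0 hj hinc.symm ⟨h', hn⟩).1 hlt

lemma BoundaryOrder.exists_realizes (h : BoundaryOrder U₁ U₂ lt) (hc : Coherent U₁ U₂ lt) :
    ∃ L, Realizes U₁ U₂ lt L := by
  obtain ⟨L, hL, hlt⟩ := hc
  refine ⟨L, hL, ?_⟩
  rintro ⟨i, j⟩ ⟨i', k⟩ hj hk
  rcases j with _ | j <;> rcases k with _ | k
  · simp only [pos_zero, lt_irrefl, iff_false]
    exact (h.incomp_zero hj.1 hk.1).1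
  · simp only [pos_zero, h.zero_lt hj.1 hk, true_iff]
    rw [← pos_zero (W := word U₁ U₂) (L := L) i']
    exact pos_lt hL (Nat.succ_pos k) hk.2
  · simp only [pos_zero, Nat.not_lt_zero, iff_false]
    exact (h.zero_lt hk.1 hj).2
  · exact hlt _ _ ⟨hj.1, Nat.succ_pos _, hj.2⟩ ⟨hk.1, Nat.succ_pos _, hk.2⟩

lemma boundaryOrder_of_pos (hL : ∀ z, 0 < L z) (hb : Bal (word U₁ U₂) L) :
    BoundaryOrder U₁ U₂ fun a b => pos (word U₁ U₂) L a < pos (word U₁ U₂) L b where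
  irrefl _ _ := lt_irrefl _
  trans _ _ _ _ _ _ := lt_trans
  incomp_trans a b c _ _ _ h1 h2 := by
    simp only [Incomp] at *
    omega
  succ i j h := pos_lt hL (Nat.lt_succ_self j) h.2
  top := ⟨(le_of_eq hb.symm).not_gt, (le_of_eq hb).not_gt⟩
  bot := by simp [Incomp]

namespace Realizes

variable (h : Realizes U₁ U₂ lt L)
include h

lemma incomp_iff {a b : ℕ × ℕ} (ha : EBoundary U₁ U₂ a) (hb : EBoundary U₁ U₂ b) :
    Incomp lt a b ↔ pos (word U₁ U₂) L a = pos (word U₁ U₂) L b := by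
  unfold Incomp
  rw [h.2 a b ha hb, h.2 b a hb ha]
  omega

lemma coherent : Coherent U₁ U₂ lt :=
  ⟨L, h.1, fun a b ha hb => h.2 a b (IsB.eBoundary ha) (IsB.eBoundary hb)⟩

lemma bal (hb : BoundaryOrder U₁ U₂ lt) : Bal (word U₁ U₂) L :=
  (h.incomp_iff (eBoundary_one le_rfl) (eBoundary_two le_rfl)).1 hb.top

lemma stag_iff : Stag (word U₁ U₂) L ↔ Staggered U₁ U₂ lt := by
  have key : ∀ j k, j ≤ U₁.length → k ≤ U₂.length →
      (pos (word U₁ U₂) L (1, j) = pos (word U₁ U₂) L (2, k) ↔ Incomp lt (1, j) (2, k)) :=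
    fun j k hj hk => (h.incomp_iff (eBoundary_one hj) (eBoundary_two hk)).symm
  exact ⟨fun hs j k hj hk he => hs j k hj hk ((key j k hj hk).2 he),
    fun hs j k hj hk he => hs j k hj hk ((key j k hj hk).1 he)⟩

lemma cuts_iff {a c : ℕ × ℕ} : Cuts U₁ U₂ lt a c ↔ Overlap (word U₁ U₂) L a c := by
  constructor
  · rintro ⟨ha, hc, hne, h1, h2⟩
    have ha' : IsB (word U₁ U₂) a := ha
    have hc' : IsB (word U₁ U₂) c := hc
    rw [h.2 _ _ ha'.eBoundary_pred hc'.eBoundary] at h1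
    rw [h.2 _ _ hc'.eBoundary_pred ha'.eBoundary] at h2
    refine ⟨ha, hc, fun he => hne (Prod.ext he ?_), h1, h2⟩
    obtain ⟨i, j⟩ := a
    obtain ⟨i', k⟩ := c
    obtain rfl : i = i' := he
    have h3 := lt_of_pos_lt h1
    have h4 := lt_of_pos_lt h2
    have h5 := ha.2.1
    have h6 := hc.2.1
    simp only at *
    omega
  · rintro ⟨ha, hc, hne, h1, h2⟩
    exact ⟨ha, hc, fun he => hne (he ▸ rfl), (h.2 _ _ ha.eBoundary_pred hc.eBoundary).2 h1,
      (h.2 _ _ hc.eBoundary_pred ha.eBoundary).2 h2⟩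

lemma same_of_mirrors {a b : ℕ × ℕ} (hm : Mirrors U₁ U₂ lt a b) : Same (word U₁ U₂) a b := by
  obtain ⟨ha, hb, hl, hne⟩ := hm
  have ha' : IsB (word U₁ U₂) a := ha
  refine ⟨ha, hb, ?_, hl⟩
  rintro rfl
  rw [h.incomp_iff ha'.eBoundary ha'.eBoundary,
    h.incomp_iff ha'.eBoundary_pred ha'.eBoundary_pred] at hne
  simp at hne

lemma mirrors_of_same (hs : Stag (word U₁ U₂) L)
    (hne : ¬ (U₁.length = 1 ∧ U₂.length = 1 ∧
      ltr (word U₁ U₂) (1, 1) = ltr (word U₁ U₂) (2, 1))) {a b : ℕ × ℕ}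
    (hab : Same (word U₁ U₂) a b) : Mirrors U₁ U₂ lt a b := by
  obtain ⟨ha, hb, hd, hl⟩ := hab
  refine ⟨ha, hb, hl, ?_⟩
  rw [h.incomp_iff ha.eBoundary hb.eBoundary, h.incomp_iff ha.eBoundary_pred hb.eBoundary_pred]
  by_contra! hc
  obtain ⟨h1, h2⟩ := hc
  have cross : ∀ j k, IsB (word U₁ U₂) (1, j) → IsB (word U₁ U₂) (2, k) →
      ltr (word U₁ U₂) (1, j) = ltr (word U₁ U₂) (2, k) →
      pos (word U₁ U₂) L (1, j) = pos (word U₁ U₂) L (2, k) →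
      pos (word U₁ U₂) L (1, j - 1) = pos (word U₁ U₂) L (2, k - 1) → False := by
    rintro j k ⟨-, hj, hj'⟩ ⟨-, hk, hk'⟩ hl h1 h2
    have h3 := hs _ _ hj' hk' h1
    have h4 := hs _ _ ((Nat.sub_le _ _).trans hj') ((Nat.sub_le _ _).trans hk') h2
    simp only at hj hk hj' hk'
    obtain rfl : j = 1 := by omega
    obtain rfl : k = 1 := by omega
    have h5 : (word U₁ U₂ 1).length = U₁.length := rfl
    have h6 : (word U₁ U₂ 2).length = U₂.length := rfl
    exact hne ⟨by omega, by omega, hl⟩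
  obtain ⟨i, j⟩ := a
  obtain ⟨i', k⟩ := b
  by_cases hi : i = i'
  · subst hi
    rcases lt_trichotomy j k with h3 | rfl | h3
    · exact (pos_lt h.1 h3 hb.2.2).ne h1
    · exact hd rfl
    · exact (pos_lt h.1 h3 ha.2.2).ne' h1
  · rcases ha.1 with h3 | h3 <;> rcases hb.1 with h4 | h4 <;> simp only at h3 h4 <;> subst h3 <;>
      subst h4
    · exact hi rfl
    · exact cross _ _ ha hb hl h1 h2
    · exact cross _ _ hb ha hl.symm h1.symm h2.symm
    · exact hi rfl

lemma acyclic_of_sAcyc (hac : SAcyc (word U₁ U₂) L) : Acyclic U₁ U₂ lt := by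
  rintro ⟨n, w, hn, hw, he⟩
  refine hac (w 0) ?_
  have := transGen_of_walk (r := Edge (word U₁ U₂) L) hn fun k hk => by
    obtain ⟨c, h1, h2⟩ := he k hk
    exact ⟨c, h.cuts_iff.1 h1, h.same_of_mirrors h2⟩
  rwa [hw] at this

lemma sAcyc_of_acyclic (hs : Stag (word U₁ U₂) L)
    (hne : ¬ (U₁.length = 1 ∧ U₂.length = 1 ∧
      ltr (word U₁ U₂) (1, 1) = ltr (word U₁ U₂) (2, 1)))
    (hac : Acyclic U₁ U₂ lt) : SAcyc (word U₁ U₂) L := by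
  intro a ha
  obtain ⟨n, hn, w, h0, hw, he⟩ := exists_walk_of_transGen ha
  refine hac ⟨n, w, hn, hw.trans h0.symm, fun k hk => ?_⟩
  obtain ⟨c, h1, h2⟩ := he k hk
  exact ⟨c, h.cuts_iff.2 h1, h.mirrors_of_same hs hne h2⟩

end Realizes

lemma word_expand_tail : word (expand x y U₁).tail (expand x y U₂).tail =
    expTail x y (word U₁ U₂) := by
  funext i
  by_cases h : i = 1 <;> simp [word, expTail, h]

lemma count_expand (hxy : x ≠ y) (l : List X) : (expand x y l).count x = l.count x := by
  induction l with
  | nil => rfl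
  | cons a l ih =>
    rw [expand_cons, List.count_append, ih, List.count_cons]
    by_cases h : a = x
    · simp [h, hxy.symm, add_comm]
    · simp [h]

namespace Heads

lemma snd_lt_of_ne {W : ℕ → List X} (h : Heads W x y) (hL : ∀ z, 0 < L z) (hyx : L y < L x)
    {b : ℕ × ℕ} (hb : IsB W b) (hb2 : b ≠ (2, 1)) : pos W L (2, 1) < pos W L b := by
  obtain ⟨i, j⟩ := b
  obtain ⟨hi, hj, hj'⟩ := hb
  simp only at hi hj hj'
  rcases hi with rfl | rfl
  · have := pos_mono (W := W) (L := L) (i := 1) hj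
    rw [h.pos_fst] at this
    rw [h.pos_snd]
    omega
  · have : j ≠ 1 := fun h => hb2 (by rw [h])
    exact pos_lt hL (by omega) hj'

lemma nu_mu (h : Heads (word U₁ U₂) x y) {b : ℕ × ℕ} (hb : IsB (word U₁ U₂) b) :
    nu (expand x y U₁).tail (expand x y U₂).tail x (mu U₁ U₂ x b) = b := by
  obtain ⟨i, j⟩ := b
  obtain ⟨hi, hj, hj'⟩ := hb
  simp only at hi hj hj'
  have h1 := take_expand (x := x) (y := y) hj'
  rw [h.expand_eq hi, show j + ((word U₁ U₂ i).take j).count x =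
    (j + ((word U₁ U₂ i).take j).count x - 1) + 1 by omega, List.take_succ_cons] at h1
  have h2 := congrArg (List.count x) h1
  rw [count_expand h.ne, List.count_cons_of_ne h.ne.symm] at h2
  simp only [nu, mu, word_expand_tail, Prod.mk.injEq, true_and]
  rw [h2]
  omega

lemma order_iff_agree (h : Heads (word U₁ U₂) x y) {L₀ : X → ℕ} (hR : Realizes U₁ U₂ lt L₀)
    (hyx : L₀ y < L₀ x)
    (hR' : Realizes (expand x y U₁).tail (expand x y U₂).tail lt' L) :
    (∀ a b, Bpminus U₁ U₂ x a → Bpminus U₁ U₂ x b →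
      (lt' a b ↔ lt (nu (expand x y U₁).tail (expand x y U₂).tail x a)
        (nu (expand x y U₁).tail (expand x y U₂).tail x b))) ↔
      Agree (word U₁ U₂) L₀ (extLen x y L) := by
  have key : ∀ a b, Bminus U₁ U₂ a → Bminus U₁ U₂ b →
      ((lt' (mu U₁ U₂ x a) (mu U₁ U₂ x b) ↔
        lt (nu (expand x y U₁).tail (expand x y U₂).tail x (mu U₁ U₂ x a))
          (nu (expand x y U₁).tail (expand x y U₂).tail x (mu U₁ U₂ x b))) ↔
      (pos (word U₁ U₂) L₀ a < pos (word U₁ U₂) L₀ b ↔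
        pos (word U₁ U₂) (extLen x y L) a < pos (word U₁ U₂) (extLen x y L) b)) := by
    rintro a b ⟨ha, ha2⟩ ⟨hb, hb2⟩
    have hea : EBoundary (expand x y U₁).tail (expand x y U₂).tail (mu U₁ U₂ x a) :=
      IsB.eBoundary (word_expand_tail (U₁ := U₁) ▸ h.isB_main ha ha2)
    have heb : EBoundary (expand x y U₁).tail (expand x y U₂).tail (mu U₁ U₂ x b) :=
      IsB.eBoundary (word_expand_tail (U₁ := U₁) ▸ h.isB_main hb hb2)
    have h1 : pos (expTail x y (word U₁ U₂)) L (mu U₁ U₂ x a) + L y = _ :=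
      h.pos_main (L := L) ha
    have h2 : pos (expTail x y (word U₁ U₂)) L (mu U₁ U₂ x b) + L y = _ :=
      h.pos_main (L := L) hb
    rw [h.nu_mu ha, h.nu_mu hb, hR.2 _ _ (IsB.eBoundary ha) (IsB.eBoundary hb),
      hR'.2 _ _ hea heb, word_expand_tail, ← h1, ← h2]
    omega
  constructor
  · intro H a b ha hb
    have hs1 := fun b => h.snd_lt_of_ne hR.1 hyx (b := b)
    have hs2 := fun b => h.snd_lt_of_ne (extLen_pos hR'.1) (h.extLen_snd_lt hR'.1) (b := b)
    by_cases ha2 : a = (2, 1) <;> by_cases hb2 : b = (2, 1)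
    · subst ha2 hb2
      simp
    · subst ha2
      exact iff_of_true (hs1 b hb hb2) (hs2 b hb hb2)
    · subst hb2
      exact iff_of_false (hs1 a ha ha2).not_gt (hs2 a ha ha2).not_gt
    · exact (key a b ⟨ha, ha2⟩ ⟨hb, hb2⟩).1
        (H _ _ ⟨a, ⟨ha, ha2⟩, rfl⟩ ⟨b, ⟨hb, hb2⟩, rfl⟩)
  · rintro H _ _ ⟨a, ha, rfl⟩ ⟨b, hb, rfl⟩
    exact (key a b ha hb).2 (H a b ha.1 hb.1)

lemma not_single_expTail {W : ℕ → List X} (h : Heads W x y) :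
    ¬ ((expTail x y W 1).length = 1 ∧ (expTail x y W 2).length = 1 ∧
      ltr (expTail x y W) (1, 1) = ltr (expTail x y W) (2, 1)) := by
  rintro ⟨-, h2, h3⟩
  have h4 := h.ltr_main h.isB_fst (by simp)
  have h5 : mainB x W (1, 1) = (1, 1) := Prod.ext rfl h.main_fst
  rw [h5, h.fst, h3] at h4
  have h6 : x ∈ expand x y (W 2) := List.mem_of_mem_tail (List.mem_of_getElem? h4)
  rw [← List.count_pos_iff, count_expand h.ne] at h6
  rw [h.length_expTail] at h2
  have h7 := h.isB_snd.2.2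
  simp only at h7
  obtain ⟨a, ha⟩ := List.length_eq_one_iff.1 (show (W 2).length = 1 by omega)
  have h8 := h.snd
  simp only [ltr, ha] at h8
  simp only [Nat.sub_self, List.getElem?_cons_zero, Option.some.injEq] at h8
  rw [ha, h8] at h6
  simp [h.ne.symm] at h6

end Heads

/-- If all staggered coherent case II successors have acyclic cut graph, and there is one, then
the cut graph is acyclic. -/
theorem exists_nielsenII_not_acyclic (hbo : BoundaryOrder U₁ U₂ lt) (hco : Coherent U₁ U₂ lt)
    (hst : Staggered U₁ U₂ lt) (hna : ¬ Acyclic U₁ U₂ lt)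
    (hE : ∃ U₁' U₂' lt', NielsenII U₁ U₂ lt U₁' U₂' lt' ∧ Coherent U₁' U₂' lt' ∧
      Staggered U₁' U₂' lt') :
    ∃ U₁' U₂' lt', NielsenII U₁ U₂ lt U₁' U₂' lt' ∧ Coherent U₁' U₂' lt' ∧
      Staggered U₁' U₂' lt' ∧ ¬ Acyclic U₁' U₂' lt' := by
  obtain ⟨L₀, hR⟩ := hbo.exists_realizes hco
  obtain ⟨_, _, lt₁, ⟨x, y, hx, hy, hlt, rfl, rfl, hbo₁, hord₁⟩, hco₁, hst₁⟩ := hE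
  obtain ⟨L₁, hR₁⟩ := hbo₁.exists_realizes hco₁
  have hfst : ltr (word U₁ U₂) (1, 1) = some x := by rwa [List.head?_eq_getElem?] at hx
  have hsnd : ltr (word U₁ U₂) (2, 1) = some y := by rwa [List.head?_eq_getElem?] at hy
  have hB₁ : IsB (word U₁ U₂) (1, 1) :=
    ⟨Or.inl rfl, le_rfl, (List.getElem?_eq_some_iff.1 hfst).1⟩
  have hB₂ : IsB (word U₁ U₂) (2, 1) :=
    ⟨Or.inr rfl, le_rfl, (List.getElem?_eq_some_iff.1 hsnd).1⟩
  have hyx : L₀ y < L₀ x := by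
    have h1 := (hR.2 _ _ hB₂.eBoundary hB₁.eBoundary).1 hlt
    rw [pos_pred le_rfl hfst, pos_pred le_rfl hsnd] at h1
    simpa using h1
  have h : Heads (word U₁ U₂) x y := ⟨hfst, hsnd, fun he => by simp [he] at hyx⟩
  by_contra! hcon
  refine hna (hR.acyclic_of_sAcyc (sAcyc_of_expTail h hR.1 hyx (hR.stag_iff.2 hst) (hR.bal hbo)
    ⟨L₁, hR₁.1, (h.order_iff_agree hR hyx hR₁).1 hord₁, ?_⟩ fun L hL hag hs => ?_))
  · rw [← word_expand_tail]
    exact hR₁.stag_iff.2 hst₁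
  · have hb := h.bal_iff.1 (hag.bal h.isB_top₁ h.isB_top₂ (hR.bal hbo))
    have hne := h.not_single_expTail
    rw [← word_expand_tail] at hs hb hne ⊢
    set lt' : BRel := fun a b => pos (word (expand x y U₁).tail (expand x y U₂).tail) L a <
      pos (word (expand x y U₁).tail (expand x y U₂).tail) L b
    have hR' : Realizes (expand x y U₁).tail (expand x y U₂).tail lt' L :=
      ⟨hL, fun _ _ _ _ => Iff.rfl⟩
    exact hR'.sAcyc_of_acyclic hs hne (hcon _ _ lt' ⟨x, y, hx, hy, hlt, rfl, rfl,
      boundaryOrder_of_pos hL hb, (h.order_iff_agree hR hyx hR').2 hag⟩ hR'.coherent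
      (hR'.stag_iff.1 hs))

end Translation

section Duality

variable {U₁ U₂ U₁' U₂' : List X} {lt lt' : BRel}

/-- Exchange of the two sides. -/
def swapSide (b : ℕ × ℕ) : ℕ × ℕ := (3 - b.1, b.2)

/-- On the two sides, `lt'` is `lt` with the sides exchanged. -/
def IsDual (lt lt' : BRel) : Prop :=
  ∀ a b : ℕ × ℕ, a.1 = 1 ∨ a.1 = 2 → b.1 = 1 ∨ b.1 = 2 →
    (lt' a b ↔ lt (swapSide a) (swapSide b))

lemma isDual_dualRel : IsDual lt (dualRel lt) := fun _ _ _ _ => Iff.rfl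

lemma swapSide_side {a : ℕ × ℕ} (h : a.1 = 1 ∨ a.1 = 2) :
    (swapSide a).1 = 1 ∨ (swapSide a).1 = 2 := by
  simp only [swapSide]
  omega

lemma swapSide_swapSide {a : ℕ × ℕ} (h : a.1 = 1 ∨ a.1 = 2) : swapSide (swapSide a) = a :=
  Prod.ext (by simp only [swapSide]; omega) rfl

lemma IsDual.symm (h : IsDual lt lt') : IsDual lt' lt := fun a b ha hb => by
  rw [h _ _ (swapSide_side ha) (swapSide_side hb), swapSide_swapSide ha, swapSide_swapSide hb]

lemma word_swap {i : ℕ} (h : i = 1 ∨ i = 2) : word U₂ U₁ i = word U₁ U₂ (3 - i) := by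
  rcases h with rfl | rfl <;> rfl

lemma EBoundary.swap {a : ℕ × ℕ} (h : EBoundary U₂ U₁ a) : EBoundary U₁ U₂ (swapSide a) :=
  ⟨swapSide_side h.1, by have := h.2; rwa [word_swap h.1] at this⟩

lemma Boundary.swap {a : ℕ × ℕ} (h : Boundary U₂ U₁ a) : Boundary U₁ U₂ (swapSide a) :=
  ⟨swapSide_side h.1, h.2.1, by have := h.2.2; rwa [word_swap h.1] at this⟩

namespace IsDual

variable (h : IsDual lt lt')
include h

lemma incomp_iff {a b : ℕ × ℕ} (ha : a.1 = 1 ∨ a.1 = 2) (hb : b.1 = 1 ∨ b.1 = 2) :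
    Incomp lt' a b ↔ Incomp lt (swapSide a) (swapSide b) := by
  unfold Incomp
  rw [h a b ha hb, h b a hb ha]

lemma boundaryOrder (hb : BoundaryOrder U₁ U₂ lt) : BoundaryOrder U₂ U₁ lt' where
  irrefl a ha := by
    rw [h _ _ ha.1 ha.1]
    exact hb.irrefl _ ha.swap
  trans a b c ha hbb hc := by
    rw [h _ _ ha.1 hbb.1, h _ _ hbb.1 hc.1, h _ _ ha.1 hc.1]
    exact hb.trans _ _ _ ha.swap hbb.swap hc.swap
  incomp_trans a b c ha hbb hc := by
    rw [h.incomp_iff ha.1 hbb.1, h.incomp_iff hbb.1 hc.1, h.incomp_iff ha.1 hc.1]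
    exact hb.incomp_trans _ _ _ ha.swap hbb.swap hc.swap
  succ i j hj := by
    rw [h (i, j) (i, j + 1) hj.1 hj.1]
    exact hb.succ _ _ hj.swap
  top := (h.incomp_iff (Or.inl rfl) (Or.inr rfl)).2 hb.top.symm
  bot := (h.incomp_iff (Or.inl rfl) (Or.inr rfl)).2 hb.bot.symm

lemma coherent (hc : Coherent U₁ U₂ lt) : Coherent U₂ U₁ lt' := by
  obtain ⟨L, hL, hlt⟩ := hc
  refine ⟨L, hL, fun a b ha hb => ?_⟩
  rw [h _ _ ha.1 hb.1, hlt _ _ ha.swap hb.swap]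
  simp only [prefixLen, swapSide, word_swap ha.1, word_swap hb.1]

lemma staggered (hs : Staggered U₁ U₂ lt) : Staggered U₂ U₁ lt' := by
  intro j j' hj hj' hi
  rw [h.incomp_iff (Or.inl rfl) (Or.inr rfl)] at hi
  have := hs j' j hj' hj hi.symm
  tauto

lemma cutEdge {a b : ℕ × ℕ} (he : CutEdge U₁ U₂ lt a b) :
    CutEdge U₂ U₁ lt' (swapSide a) (swapSide b) := by
  obtain ⟨c, ⟨ha, hc, hne, h1, h2⟩, -, hb, hl, hm⟩ := he
  have letter_swap : ∀ {d : ℕ × ℕ}, Boundary U₁ U₂ d →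
      letter U₂ U₁ (swapSide d) = letter U₁ U₂ d := fun {d} hd => by
    simp only [letter, swapSide, word_swap hd.1]
  refine ⟨swapSide c, ⟨ha.swap, hc.swap, fun he => hne ?_, ?_, ?_⟩, hc.swap, hb.swap, ?_, ?_⟩
  · rw [← swapSide_swapSide ha.1, he, swapSide_swapSide hc.1]
  · exact (h.symm (a.1, a.2 - 1) c ha.1 hc.1).1 h1
  · exact (h.symm (c.1, c.2 - 1) a hc.1 ha.1).1 h2
  · rw [letter_swap hc, letter_swap hb, hl]
  · rw [h.symm.incomp_iff hc.1 hb.1,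
      h.symm.incomp_iff (a := (c.1, c.2 - 1)) (b := (b.1, b.2 - 1)) hc.1 hb.1] at hm
    exact hm

lemma not_acyclic (hna : ¬ Acyclic U₁ U₂ lt) : ¬ Acyclic U₂ U₁ lt' := by
  unfold Acyclic at *
  rw [not_not] at *
  obtain ⟨n, w, hn, hw, he⟩ := hna
  exact ⟨n, fun k => swapSide (w k), hn, by simp only [hw], fun k hk => h.cutEdge (he k hk)⟩

end IsDual

lemma NielsenII.congr {lt'' : BRel} (h : NielsenII U₁ U₂ lt U₁' U₂' lt')
    (hd : ∀ a b : ℕ × ℕ, a.1 = 1 ∨ a.1 = 2 → b.1 = 1 ∨ b.1 = 2 → (lt'' a b ↔ lt' a b)) :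
    NielsenII U₁ U₂ lt U₁' U₂' lt'' := by
  obtain ⟨x, y, hx, hy, hlt, h1, h2, hb, ho⟩ := h
  refine ⟨x, y, hx, hy, hlt, h1, h2, ?_, ?_⟩
  · refine IsDual.boundaryOrder (lt := dualRel lt') (fun a b ha hb => ?_)
      (isDual_dualRel.boundaryOrder hb)
    rw [hd a b ha hb]
    exact isDual_dualRel.symm a b ha hb
  · rintro a b ⟨a', ha', rfl⟩ ⟨b', hb', rfl⟩
    rw [hd (mu U₁ U₂ x a') (mu U₁ U₂ x b') ha'.1.1 hb'.1.1]
    exact ho _ _ ⟨a', ha', rfl⟩ ⟨b', hb', rfl⟩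

end Duality

section Descent

variable {U₁ U₂ U₁' U₂' : List X} {lt lt' : BRel}

lemma acyclic_of_length_eq_one (hb : BoundaryOrder U₁ U₂ lt) (h1 : U₁.length = 1)
    (h2 : U₂.length = 1) : Acyclic U₁ U₂ lt := by
  rintro ⟨n, w, hn, -, he⟩
  obtain ⟨c, -, hc, hd, -, hm⟩ := he 0 hn
  have htop := hb.top
  rw [h1, h2] at htop
  have hone : ∀ {d}, Boundary U₁ U₂ d → d = (1, 1) ∨ d = (2, 1) := by
    rintro ⟨i, j⟩ ⟨hi, hj, hj'⟩
    simp only at hi hj hj'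
    rcases hi with rfl | rfl
    · have : (word U₁ U₂ 1).length = U₁.length := rfl
      exact Or.inl (Prod.ext rfl (by simp only; omega))
    · have : (word U₁ U₂ 2).length = U₂.length := rfl
      exact Or.inr (Prod.ext rfl (by simp only; omega))
  have hinc : Incomp lt c (w (0 + 1)) := by
    have hc1 := hb.irrefl _ (IsB.eBoundary hc)
    have hd1 := hb.irrefl _ (IsB.eBoundary hd)
    rcases hone hc with h3 | h3 <;> rcases hone hd with h4 | h4 <;>
      rw [h3] at hc1 ⊢ <;> rw [h4]
    · exact ⟨hc1, hc1⟩
    · exact htop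
    · exact htop.symm
    · exact ⟨hc1, hc1⟩
  have hpinc : Incomp lt (c.1, c.2 - 1) ((w (0 + 1)).1, (w (0 + 1)).2 - 1) := by
    have hpred : ∀ {d}, Boundary U₁ U₂ d → d.2 - 1 = 0 := fun hd => by
      rcases hone hd with h3 | h3 <;> simp [h3]
    rw [hpred hc, hpred hd]
    exact hb.incomp_zero hc.1 hd.1
  exact hm.elim (· hinc) (· hpinc)

/-- A staggered coherent equation whose cut graph has a cycle and which admits a staggered
coherent successor admits one whose cut graph has a cycle. -/
theorem exists_cohNielsen_not_acyclic (hst : Staggered U₁ U₂ lt) (hna : ¬ Acyclic U₁ U₂ lt)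
    (hE : ∃ U₁' U₂' lt', CohNielsen U₁ U₂ lt U₁' U₂' lt' ∧ Staggered U₁' U₂' lt') :
    ∃ U₁' U₂' lt', CohNielsen U₁ U₂ lt U₁' U₂' lt' ∧ Staggered U₁' U₂' lt' ∧
      ¬ Acyclic U₁' U₂' lt' := by
  obtain ⟨U₁', U₂', lt', ⟨⟨hU₁, hU₂, hbo, hco, hN⟩, hco'⟩, hst'⟩ := hE
  rcases hN with ⟨x, y, -, -, hinc, -⟩ | hN | hN
  · have h1 := List.length_pos_iff.2 hU₁
    have h2 := List.length_pos_iff.2 hU₂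
    have h3 := hst 1 1 h1 h2 hinc
    exact absurd (acyclic_of_length_eq_one hbo (by omega) (by omega)) hna
  · obtain ⟨V₁, V₂, lt₁, h1, h2, h3, h4⟩ :=
      exists_nielsenII_not_acyclic hbo hco hst hna ⟨_, _, _, hN, hco', hst'⟩
    exact ⟨V₁, V₂, lt₁, ⟨⟨hU₁, hU₂, hbo, hco, Or.inr (Or.inl h1)⟩, h2⟩, h3, h4⟩
  · have hd : IsDual lt (dualRel lt) := isDual_dualRel
    have hd' : IsDual lt' (dualRel lt') := isDual_dualRel
    obtain ⟨V₂, V₁, lt₁, h1, h2, h3, h4⟩ :=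
      exists_nielsenII_not_acyclic (hd.boundaryOrder hbo) (hd.coherent hco) (hd.staggered hst)
        (hd.not_acyclic hna) ⟨_, _, _, hN, hd'.coherent hco', hd'.staggered hst'⟩
    have hd₁ : IsDual lt₁ (dualRel lt₁) := isDual_dualRel
    refine ⟨V₁, V₂, dualRel lt₁, ⟨⟨hU₁, hU₂, hbo, hco, Or.inr (Or.inr ?_)⟩, hd₁.coherent h2⟩,
      hd₁.staggered h3, hd₁.not_acyclic h4⟩
    exact h1.congr fun a b ha hb => (hd₁.symm a b ha hb).symm

end Descent

/-- **Theorem (necessary condition for termination).**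
If `(U₁,U₂,<)` is a hereditarily staggered extended word equation that is terminating,
then its cut graph is acyclic. -/
theorem acyclic_cut_graph_of_terminating_hereditarily_staggered
    (U₁ U₂ : List X) (lt : BRel)
    (hhs : HereditarilyStaggered U₁ U₂ lt) (hterm : Terminating U₁ U₂ lt) :
    Acyclic U₁ U₂ lt := by
  by_contra hna
  obtain ⟨P, hP, hU⟩ := hhs
  have step : ∀ s : {s : List X × List X × BRel // P s.1 s.2.1 s.2.2 ∧ ¬ Acyclic s.1 s.2.1 s.2.2},
      ∃ t : {s : List X × List X × BRel // P s.1 s.2.1 s.2.2 ∧ ¬ Acyclic s.1 s.2.1 s.2.2},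
        CohNielsen s.1.1 s.1.2.1 s.1.2.2 t.1.1 t.1.2.1 t.1.2.2 := by
    rintro ⟨⟨V₁, V₂, lt₁⟩, hV, hVna⟩
    obtain ⟨hbo, -, hst, hex, hcl⟩ := hP _ _ _ hV
    have hne : V₁ ≠ [] ∧ V₂ ≠ [] := by
      obtain ⟨n, w, hn, -, he⟩ := not_not.1 hVna
      obtain ⟨c, ⟨ha, -⟩, -⟩ := he 0 hn
      have hz := hbo.bot
      have ht := hbo.top
      have h1 : ∀ i j, EBoundary V₁ V₂ (i, j) → 0 < j → (lt₁ (1, 0) (i, j)) ∧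
          lt₁ (2, 0) (i, j) := by
        rintro i (_ | j) hj h0
        · simp at h0
        · exact ⟨(hbo.zero_lt (Or.inl rfl) hj).1, (hbo.zero_lt (Or.inr rfl) hj).1⟩
      have h2 : 0 < V₁.length → 0 < V₂.length := fun h => by
        by_contra h3
        rw [show V₂.length = 0 by omega] at ht
        exact ht.2 (h1 _ _ (eBoundary_one le_rfl) h).2
      have h3 : 0 < V₂.length → 0 < V₁.length := fun h => by
        by_contra h3
        rw [show V₁.length = 0 by omega] at ht
        exact ht.1 (h1 _ _ (eBoundary_two le_rfl) h).1
      have h4 : 0 < V₁.length ∨ 0 < V₂.length := by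
        obtain ⟨hi, hj, hj'⟩ := ha
        rcases hi with hi | hi <;> rw [hi] at hj'
        · exact Or.inl (lt_of_lt_of_le hj hj')
        · exact Or.inr (lt_of_lt_of_le hj hj')
      rw [← List.length_pos_iff, ← List.length_pos_iff]
      tauto
    obtain ⟨V₁', V₂', lt₂, h1, h2, h3⟩ :=
      exists_cohNielsen_not_acyclic hst hVna (hex hne.1 hne.2)
    exact ⟨⟨(V₁', V₂', lt₂), hcl _ _ _ h1 h2, h3⟩, h1⟩
  choose next hnext using step
  refine hterm ⟨fun n => (next^[n] ⟨(U₁, U₂, lt), hU, hna⟩).1, rfl, fun n => ?_⟩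
  simp only [Function.iterate_succ_apply']
  exact hnext _

end ExtWordEq
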